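/- arXiv:1802.07953 — 11 statements merged into one kernel-verified Lean document; each statement's English description precedes it below -/
import Mathlib

section
/- Let Γ_{ij}^k (i,j,k ∈ {1,2}) be real constants with Γ_{ij}^k = Γ_{ji}^k, and let μ ∈ ℝ. Suppose f : ℝ² → ℝ is smooth and satisfies the affine quasi-Einstein equation (Hf)_{ij} = μ·f·ρ_{ij} at every point of ℝ² for all i,j ∈ {1,2}. If there is a point P ∈ ℝ² with f(P) = 0 and ∂₁f(P) = ∂₂f(P) = 0, then f vanishes identically on ℝ². -/
/-- The standard coordinate directions in `ℝ × ℝ`. -/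
def coordVec : Fin 2 → ℝ × ℝ := ![(1, 0), (0, 1)]

/-- The `i`-th partial derivative of `f : ℝ × ℝ → ℝ`. -/
noncomputable def pd (i : Fin 2) (f : ℝ × ℝ → ℝ) : ℝ × ℝ → ℝ :=
  fun p => fderiv ℝ f p (coordVec i)

/-- The affine Hessian `(Hf)_{ij} = ∂_i ∂_j f − Σ_k Γ_{ij}^k ∂_k f` for constant
Christoffel symbols `Γ`. -/
noncomputable def affHess (Γ : Fin 2 → Fin 2 → Fin 2 → ℝ) (f : ℝ × ℝ → ℝ)
    (i j : Fin 2) (p : ℝ × ℝ) : ℝ :=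
  pd i (pd j f) p - ∑ k, Γ i j k * pd k f p

/-- The Ricci tensor `ρ_{jk} = Σ_m (Γ_{1m}^1 + Γ_{2m}^2) Γ_{jk}^m − Σ_{i,m} Γ_{jm}^i Γ_{ik}^m`
of the connection with constant Christoffel symbols `Γ`. -/
def ricci (Γ : Fin 2 → Fin 2 → Fin 2 → ℝ) (j k : Fin 2) : ℝ :=
  (∑ m, (Γ 0 m 0 + Γ 1 m 1) * Γ j k m) - ∑ i, ∑ m, Γ j m i * Γ i k m

theorem pd_contDiff (f : ℝ × ℝ → ℝ) (hf : ContDiff ℝ (⊤ : ℕ∞) f) (i : Fin 2) :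
    ContDiff ℝ (⊤ : ℕ∞) (pd i f) := by
  unfold pd
  exact (hf.fderiv_right (m := (⊤ : ℕ∞)) (by simp)).clm_apply contDiff_const

theorem line_deriv (h : ℝ × ℝ → ℝ) (hh : ContDiff ℝ (⊤ : ℕ∞) h) (P v : ℝ × ℝ) (t : ℝ) :
    HasDerivAt (fun t : ℝ => h (P + t • v))
      (v.1 * pd 0 h (P + t • v) + v.2 * pd 1 h (P + t • v)) t := by
  have h1 : HasDerivAt (fun t : ℝ => P + t • v) v t := by
    simpa using ((hasDerivAt_id t).smul_const v).const_add P
  have h2 : HasFDerivAt h (fderiv ℝ h (P + t • v)) (P + t • v) :=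
    (hh.differentiable (by simp) _).hasFDerivAt
  have h3 := h2.comp_hasDerivAt t h1
  have hv : v = v.1 • coordVec 0 + v.2 • coordVec 1 := by
    ext <;> simp [coordVec]
  have h4 : ∀ L : (ℝ × ℝ) →L[ℝ] ℝ,
      L v = v.1 * L (coordVec 0) + v.2 * L (coordVec 1) := by
    intro L
    have := congrArg L hv
    rwa [map_add, map_smul, map_smul, smul_eq_mul, smul_eq_mul] at this
  rw [h4] at h3
  exact h3

/-- If a smooth solution of the affine quasi-Einstein equation on `ℝ²` (for a Type A
connection with constant Christoffel symbols) vanishes together with its first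
derivatives at one point, it vanishes identically. -/
theorem stmt0 (Γ : Fin 2 → Fin 2 → Fin 2 → ℝ) (hΓ : ∀ i j k, Γ i j k = Γ j i k)
    (μ : ℝ) (f : ℝ × ℝ → ℝ) (hf : ContDiff ℝ (⊤ : ℕ∞) f)
    (heq : ∀ p : ℝ × ℝ, ∀ i j : Fin 2, affHess Γ f i j p = μ * f p * ricci Γ i j)
    (P : ℝ × ℝ) (hP0 : f P = 0) (hP1 : pd 0 f P = 0) (hP2 : pd 1 f P = 0) :
    ∀ p : ℝ × ℝ, f p = 0 := by
  intro p
  set v : ℝ × ℝ := p - P with hv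
  let a : (ℝ × ℝ × ℝ) →L[ℝ] ℝ := ContinuousLinearMap.fst ℝ ℝ (ℝ × ℝ)
  let b : (ℝ × ℝ × ℝ) →L[ℝ] ℝ :=
    (ContinuousLinearMap.fst ℝ ℝ ℝ).comp (ContinuousLinearMap.snd ℝ ℝ (ℝ × ℝ))
  let c : (ℝ × ℝ × ℝ) →L[ℝ] ℝ :=
    (ContinuousLinearMap.snd ℝ ℝ ℝ).comp (ContinuousLinearMap.snd ℝ ℝ (ℝ × ℝ))
  let r (i j : Fin 2) : (ℝ × ℝ × ℝ) →L[ℝ] ℝ :=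
    Γ i j 0 • b + Γ i j 1 • c + (μ * ricci Γ i j) • a
  let A : (ℝ × ℝ × ℝ) →L[ℝ] (ℝ × ℝ × ℝ) :=
    (v.1 • b + v.2 • c).prod
      ((v.1 • r 0 0 + v.2 • r 1 0).prod (v.1 • r 0 1 + v.2 • r 1 1))
  let U : ℝ → ℝ × ℝ × ℝ := fun t =>
    (f (P + t • v), pd 0 f (P + t • v), pd 1 f (P + t • v))
  have key : ∀ q i j, pd i (pd j f) q = r i j (f q, pd 0 f q, pd 1 f q) := by
    intro q i j
    have := heq q i j
    simp only [affHess, Fin.sum_univ_two] at this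
    simp only [r, a, b, c, ContinuousLinearMap.add_apply, ContinuousLinearMap.smul_apply,
      ContinuousLinearMap.comp_apply, ContinuousLinearMap.coe_fst',
      ContinuousLinearMap.coe_snd', smul_eq_mul]
    linarith
  have hU : ∀ t, HasDerivAt U (A (U t)) t := by
    intro t
    have e0 := line_deriv f hf P v t
    have e1 := line_deriv _ (pd_contDiff f hf 0) P v t
    have e2 := line_deriv _ (pd_contDiff f hf 1) P v t
    rw [key, key] at e1 e2
    exact e0.prodMk (e1.prodMk e2)
  have hU0 : U 0 = 0 := by simp [U, hP0, hP1, hP2]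
  have hEq : U = fun _ => 0 :=
    ODE_solution_unique_univ (v := fun _ => A) (s := fun _ => Set.univ) (K := ‖A‖₊) (t₀ := 0)
      (fun _ => A.lipschitz.lipschitzOnWith) (fun t => ⟨hU t, trivial⟩)
      (fun t => ⟨by simpa using hasDerivAt_const t (0 : ℝ × ℝ × ℝ), trivial⟩) hU0
  have := congrArg Prod.fst (congrFun hEq 1)
  simpa [U, hv] using this
end

section
/- Let Γ_{ij}^k (i,j,k ∈ {1,2}) be real constants with Γ_{ij}^k = Γ_{ji}^k, and let μ ∈ ℝ. The set E(μ) of smooth functions f : ℝ² → ℝ satisfying (Hf)_{ij} = μ·f·ρ_{ij} on all of ℝ² for all i,j ∈ {1,2} is a real vector subspace of C^∞(ℝ²) of dimension at most 3. -/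
theorem pd_smooth {f : ℝ × ℝ → ℝ} (hf : ContDiff ℝ (⊤ : ℕ∞) f) (i : Fin 2) :
    ContDiff ℝ (⊤ : ℕ∞) (pd i f) := by
  unfold pd
  exact (hf.fderiv_right (m := (⊤ : ℕ∞)) (by simp)).clm_apply contDiff_const

theorem smooth_diff {f : ℝ × ℝ → ℝ} (hf : ContDiff ℝ (⊤ : ℕ∞) f) : Differentiable ℝ f :=
  hf.differentiable (by simp)

theorem pd_add {f g : ℝ × ℝ → ℝ} (hf : ContDiff ℝ (⊤ : ℕ∞) f) (hg : ContDiff ℝ (⊤ : ℕ∞) g)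
    (i : Fin 2) : pd i (f + g) = pd i f + pd i g := by
  funext p
  simp only [pd, Pi.add_apply]
  rw [fderiv_add (smooth_diff hf p) (smooth_diff hg p)]
  rfl

theorem pd_smul {f : ℝ × ℝ → ℝ} (hf : ContDiff ℝ (⊤ : ℕ∞) f) (c : ℝ)
    (i : Fin 2) : pd i (c • f) = c • pd i f := by
  funext p
  simp only [pd, Pi.smul_apply]
  rw [fderiv_const_smul (smooth_diff hf p) c]
  rfl

theorem pd_zero (i : Fin 2) : pd i 0 = 0 := by
  funext p
  simp [pd]

theorem ray_deriv {f : ℝ × ℝ → ℝ} (hf : ContDiff ℝ (⊤ : ℕ∞) f) (p : ℝ × ℝ) (t : ℝ) :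
    HasDerivAt (fun s : ℝ => f (s • p)) (p.1 * pd 0 f (t • p) + p.2 * pd 1 f (t • p)) t := by
  have h1 : HasDerivAt (fun s : ℝ => s • p) p t := by
    simpa using (hasDerivAt_id t).smul_const p
  have h2 := (smooth_diff hf (t • p)).hasFDerivAt.comp_hasDerivAt t h1
  have hp : p = p.1 • ((1 : ℝ), (0 : ℝ)) + p.2 • ((0 : ℝ), (1 : ℝ)) := by
    ext <;> simp
  have hL : ∀ L : ℝ × ℝ →L[ℝ] ℝ, L p = p.1 * L (1, 0) + p.2 * L (0, 1) := by
    intro L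
    conv_lhs => rw [hp]
    rw [map_add, map_smul, map_smul]; rfl
  rw [hL] at h2
  exact h2

noncomputable def solSpace (Γ : Fin 2 → Fin 2 → Fin 2 → ℝ) (μ : ℝ) : Submodule ℝ (ℝ × ℝ → ℝ) where
  carrier := {f : ℝ × ℝ → ℝ | ContDiff ℝ (⊤ : ℕ∞) f ∧
          ∀ p : ℝ × ℝ, ∀ i j : Fin 2, affHess Γ f i j p = μ * f p * ricci Γ i j}
  zero_mem' := ⟨contDiff_const, by intro p i j; simp [affHess, pd_zero]⟩
  add_mem' := by
    rintro f g ⟨hf, hf'⟩ ⟨hg, hg'⟩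
    refine ⟨hf.add hg, fun p i j => ?_⟩
    have h1 := hf' p i j
    have h2 := hg' p i j
    simp only [affHess, Fin.sum_univ_two] at h1 h2 ⊢
    simp only [pd_add hf hg, pd_add (pd_smooth hf j) (pd_smooth hg j), Pi.add_apply]
    linear_combination h1 + h2
  smul_mem' := by
    rintro c f ⟨hf, hf'⟩
    refine ⟨contDiff_const.smul hf, fun p i j => ?_⟩
    have h1 := hf' p i j
    simp only [affHess, Fin.sum_univ_two] at h1 ⊢
    simp only [pd_smul hf, pd_smul (pd_smooth hf j), Pi.smul_apply, smul_eq_mul]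
    linear_combination c * h1

theorem sol_eq_zero (Γ : Fin 2 → Fin 2 → Fin 2 → ℝ) (μ : ℝ) {f : ℝ × ℝ → ℝ}
    (hf : ContDiff ℝ (⊤ : ℕ∞) f)
    (h : ∀ p : ℝ × ℝ, ∀ i j : Fin 2, affHess Γ f i j p = μ * f p * ricci Γ i j)
    (h0 : f 0 = 0) (h1 : pd 0 f 0 = 0) (h2 : pd 1 f 0 = 0) : f = 0 := by
  funext p
  let M : Matrix (Fin 3) (Fin 3) ℝ :=
    !![0, p.1, p.2;
      p.1 * (μ * ricci Γ 0 0) + p.2 * (μ * ricci Γ 1 0),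
        p.1 * Γ 0 0 0 + p.2 * Γ 1 0 0, p.1 * Γ 0 0 1 + p.2 * Γ 1 0 1;
      p.1 * (μ * ricci Γ 0 1) + p.2 * (μ * ricci Γ 1 1),
        p.1 * Γ 0 1 0 + p.2 * Γ 1 1 0, p.1 * Γ 0 1 1 + p.2 * Γ 1 1 1]
  let A : (Fin 3 → ℝ) →L[ℝ] (Fin 3 → ℝ) := (Matrix.toLin' M).toContinuousLinearMap
  let u : ℝ → Fin 3 → ℝ := fun t => ![f (t • p), pd 0 f (t • p), pd 1 f (t • p)]
  have hu : ∀ t, HasDerivAt u (A (u t)) t := by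
    intro t
    rw [hasDerivAt_pi]
    have key : ∀ j, p.1 * pd 0 (pd j f) (t • p) + p.2 * pd 1 (pd j f) (t • p) =
        (p.1 * (μ * ricci Γ 0 j) + p.2 * (μ * ricci Γ 1 j)) * f (t • p) +
        (p.1 * Γ 0 j 0 + p.2 * Γ 1 j 0) * pd 0 f (t • p) +
        (p.1 * Γ 0 j 1 + p.2 * Γ 1 j 1) * pd 1 f (t • p) := by
      intro j
      have e0 := h (t • p) 0 j
      have e1 := h (t • p) 1 j
      simp only [affHess, Fin.sum_univ_two] at e0 e1
      linear_combination p.1 * e0 + p.2 * e1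
    intro i
    fin_cases i
    · refine (ray_deriv hf p t).congr_deriv ?_
      simp [A, M, u, Matrix.mulVec, dotProduct, Fin.sum_univ_three]
    · refine (ray_deriv (pd_smooth hf 0) p t).congr_deriv ?_
      rw [key]
      simp [A, M, u, Matrix.mulVec, dotProduct, Fin.sum_univ_three]
    · refine (ray_deriv (pd_smooth hf 1) p t).congr_deriv ?_
      rw [key]
      simp [A, M, u, Matrix.mulVec, dotProduct, Fin.sum_univ_three]
  have hz : ∀ t, HasDerivAt (fun _ : ℝ => (0 : Fin 3 → ℝ)) (A 0) t := by
    intro t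
    rw [map_zero]
    exact hasDerivAt_const t _
  have := ODE_solution_unique_univ (v := fun _ x => A x) (s := fun _ => Set.univ)
    (K := ‖A‖₊) (t₀ := 0) (f := u) (g := fun _ => 0)
    (fun _ => A.lipschitz.lipschitzOnWith) (fun t => ⟨hu t, trivial⟩)
    (fun t => ⟨hz t, trivial⟩)
    (by ext i; fin_cases i <;> simp [u, h0, h1, h2])
  have h3 := congrFun (congrFun this 1) 0
  simpa [u] using h3

noncomputable def evalData (Γ : Fin 2 → Fin 2 → Fin 2 → ℝ) (μ : ℝ) : solSpace Γ μ →ₗ[ℝ] (Fin 3 → ℝ) where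
  toFun f := ![f.1 0, pd 0 f.1 0, pd 1 f.1 0]
  map_add' f g := by
    have hf := f.2.1
    have hg := g.2.1
    ext i
    fin_cases i <;> simp [pd_add hf hg]
  map_smul' c f := by
    have hf := f.2.1
    ext i
    fin_cases i <;> simp [pd_smul hf]

/-- The set `E(μ)` of smooth solutions of the affine quasi-Einstein equation on `ℝ²`
(for a Type A connection with constant Christoffel symbols) is a real vector subspace
of the space of functions, of dimension at most `3`. -/
theorem stmt1 (Γ : Fin 2 → Fin 2 → Fin 2 → ℝ) (hΓ : ∀ i j k, Γ i j k = Γ j i k)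
    (μ : ℝ) :
    ∃ V : Submodule ℝ (ℝ × ℝ → ℝ),
      (V : Set (ℝ × ℝ → ℝ)) =
        {f : ℝ × ℝ → ℝ | ContDiff ℝ (⊤ : ℕ∞) f ∧
          ∀ p : ℝ × ℝ, ∀ i j : Fin 2, affHess Γ f i j p = μ * f p * ricci Γ i j} ∧
      Module.rank ℝ V ≤ 3 := by
  refine ⟨solSpace Γ μ, rfl, ?_⟩
  have hinj : Function.Injective (evalData Γ μ) := by
    rw [injective_iff_map_eq_zero]
    intro f hf
    apply Subtype.ext
    refine sol_eq_zero Γ μ f.2.1 f.2.2 ?_ ?_ ?_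
    · exact congrFun hf 0
    · exact congrFun hf 1
    · exact congrFun hf 2
  have := LinearMap.rank_le_of_injective (evalData Γ μ) hinj
  simpa using this
end

section
/- Let C_{ij}^k (i,j,k ∈ {1,2}) be real constants with C_{ij}^k = C_{ji}^k, let μ ∈ ℝ, and consider the Type B connection on the half-plane {x¹ > 0} with Christoffel symbols Γ_{ij}^k = C_{ij}^k/x¹. Suppose α₁ ≠ α₂ are real numbers such that both f₁(x¹,x²) = (x¹)^{α₁} and f₂(x¹,x²) = (x¹)^{α₂} satisfy the affine quasi-Einstein equation Hf = μ·f·ρ_s on the half-plane. Then C_{12}^1 = 0, C_{22}^1 = 0, μ·C_{22}^2 = 0, and for i = 1,2 one has α_i² − α_i(1 + C_{11}^1) − (C_{12}^2 + C_{11}^1·C_{12}^2 − (C_{12}^2)²)·μ = 0. -/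
/-- Partial derivative in the first coordinate direction. -/
noncomputable def pd1 (f : ℝ × ℝ → ℝ) : ℝ × ℝ → ℝ := fun p => fderiv ℝ f p (1, 0)

/-- Partial derivative in the second coordinate direction. -/
noncomputable def pd2 (f : ℝ × ℝ → ℝ) : ℝ × ℝ → ℝ := fun p => fderiv ℝ f p (0, 1)

theorem hfd (α : ℝ) (p : ℝ × ℝ) (hp : 0 < p.1) :
    HasFDerivAt (fun q : ℝ × ℝ => q.1 ^ α)
      ((α * p.1 ^ (α - 1)) • ContinuousLinearMap.fst ℝ ℝ ℝ) p := by
  have h := (Real.hasDerivAt_rpow_const (x := p.1) (p := α) (Or.inl hp.ne')).comp_hasFDerivAt p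
    (hasFDerivAt_fst (𝕜 := ℝ) (p := p))
  exact h

theorem pd1_pow (α : ℝ) (p : ℝ × ℝ) (hp : 0 < p.1) :
    pd1 (fun q : ℝ × ℝ => q.1 ^ α) p = α * p.1 ^ (α - 1) := by
  unfold pd1
  rw [(hfd α p hp).fderiv]; simp

theorem pd2_pow (α : ℝ) (p : ℝ × ℝ) (hp : 0 < p.1) :
    pd2 (fun q : ℝ × ℝ => q.1 ^ α) p = 0 := by
  unfold pd2
  rw [(hfd α p hp).fderiv]; simp

theorem ev_pos (p : ℝ × ℝ) (hp : 0 < p.1) : ∀ᶠ q : ℝ × ℝ in nhds p, 0 < q.1 :=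
  continuous_fst.continuousAt.eventually (lt_mem_nhds hp)

theorem fd1 (α : ℝ) (p : ℝ × ℝ) (hp : 0 < p.1) :
    fderiv ℝ (pd1 (fun q : ℝ × ℝ => q.1 ^ α)) p =
      α • ((α - 1) * p.1 ^ (α - 1 - 1)) • ContinuousLinearMap.fst ℝ ℝ ℝ := by
  have h : pd1 (fun q : ℝ × ℝ => q.1 ^ α) =ᶠ[nhds p] fun q => α * q.1 ^ (α - 1) :=
    (ev_pos p hp).mono fun q hq => pd1_pow α q hq
  rw [h.fderiv_eq]
  exact ((hfd (α - 1) p hp).const_mul α).fderiv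

theorem fd2 (α : ℝ) (p : ℝ × ℝ) (hp : 0 < p.1) :
    fderiv ℝ (pd2 (fun q : ℝ × ℝ => q.1 ^ α)) p = 0 := by
  have h : pd2 (fun q : ℝ × ℝ => q.1 ^ α) =ᶠ[nhds p] fun _ => (0 : ℝ) :=
    (ev_pos p hp).mono fun q hq => pd2_pow α q hq
  rw [h.fderiv_eq]
  simp

/-- If `(x¹)^{α₁}` and `(x¹)^{α₂}` with `α₁ ≠ α₂` both solve the affine quasi-Einstein
equation `Hf = μ f ρ_s` for the Type B connection `Γ_{ij}^k = C_{ij}^k/x¹` on the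
half-plane `{x¹ > 0}`, then `C_{12}^1 = 0`, `C_{22}^1 = 0`, `μ C_{22}^2 = 0` and each
`α_i` satisfies `α² − α(1 + C_{11}^1) − (C_{12}^2 + C_{11}^1 C_{12}^2 − (C_{12}^2)²) μ = 0`. -/
theorem stmt2 (C111 C112 C121 C122 C221 C222 μ α₁ α₂ : ℝ) (hα : α₁ ≠ α₂)
    -- abbreviations for the entries of ρ̃ = (x¹)²·ρ
    (ρ11 ρ12 ρ21 ρ22 : ℝ)
    (hρ11 : ρ11 = C122 * (1 + C111 - C122) + C112 * (C222 - C121))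
    (hρ12 : ρ12 = C222 - C112 * C221)
    (hρ21 : ρ21 = -C121 + C121 * C122 - C112 * C221)
    (hρ22 : ρ22 = C221 * (C111 - C122 - 1) + C121 * C222 - C121 ^ 2)
    -- both power functions solve the quasi-Einstein equation on the half-plane
    (hsol : ∀ α ∈ ({α₁, α₂} : Set ℝ), ∀ p : ℝ × ℝ, 0 < p.1 →
      (pd1 (pd1 (fun q : ℝ × ℝ => q.1 ^ α)) p
          - (C111 / p.1) * pd1 (fun q : ℝ × ℝ => q.1 ^ α) p
          - (C112 / p.1) * pd2 (fun q : ℝ × ℝ => q.1 ^ α) p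
        = μ * p.1 ^ α * (ρ11 / p.1 ^ 2)) ∧
      (pd1 (pd2 (fun q : ℝ × ℝ => q.1 ^ α)) p
          - (C121 / p.1) * pd1 (fun q : ℝ × ℝ => q.1 ^ α) p
          - (C122 / p.1) * pd2 (fun q : ℝ × ℝ => q.1 ^ α) p
        = μ * p.1 ^ α * (((ρ12 + ρ21) / 2) / p.1 ^ 2)) ∧
      (pd2 (pd1 (fun q : ℝ × ℝ => q.1 ^ α)) p
          - (C121 / p.1) * pd1 (fun q : ℝ × ℝ => q.1 ^ α) p
          - (C122 / p.1) * pd2 (fun q : ℝ × ℝ => q.1 ^ α) p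
        = μ * p.1 ^ α * (((ρ12 + ρ21) / 2) / p.1 ^ 2)) ∧
      (pd2 (pd2 (fun q : ℝ × ℝ => q.1 ^ α)) p
          - (C221 / p.1) * pd1 (fun q : ℝ × ℝ => q.1 ^ α) p
          - (C222 / p.1) * pd2 (fun q : ℝ × ℝ => q.1 ^ α) p
        = μ * p.1 ^ α * (ρ22 / p.1 ^ 2))) :
    C121 = 0 ∧ C221 = 0 ∧ μ * C222 = 0 ∧
    (∀ α ∈ ({α₁, α₂} : Set ℝ),
      α ^ 2 - α * (1 + C111) - (C122 + C111 * C122 - C122 ^ 2) * μ = 0) := by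
  have key : ∀ α ∈ ({α₁, α₂} : Set ℝ), α * (α - 1) - C111 * α = μ * ρ11 ∧
      -(C121 * α) = μ * ((ρ12 + ρ21) / 2) ∧ -(C221 * α) = μ * ρ22 := by
    intro α hm
    have hp : (0 : ℝ) < ((1, 0) : ℝ × ℝ).1 := by norm_num
    obtain ⟨h1, h2, -, h4⟩ := hsol α hm (1, 0) hp
    have e11 : pd1 (pd1 (fun q : ℝ × ℝ => q.1 ^ α)) (1, 0) = α * (α - 1) := by
      rw [pd1, fd1 α _ hp]; simp
    have e12 : pd1 (pd2 (fun q : ℝ × ℝ => q.1 ^ α)) (1, 0) = 0 := by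
      rw [pd1, fd2 α _ hp]; simp
    have e22 : pd2 (pd2 (fun q : ℝ × ℝ => q.1 ^ α)) (1, 0) = 0 := by
      rw [pd2, fd2 α _ hp]; simp
    rw [e11, pd1_pow α _ hp, pd2_pow α _ hp] at h1
    rw [e12, pd1_pow α _ hp, pd2_pow α _ hp] at h2
    rw [e22, pd1_pow α _ hp, pd2_pow α _ hp] at h4
    simp only [Real.one_rpow, one_pow, div_one, mul_one, mul_zero, sub_zero, zero_sub] at h1 h2 h4
    exact ⟨h1, h2, h4⟩
  obtain ⟨a1, a2, a3⟩ := key α₁ (by simp)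
  obtain ⟨b1, b2, b3⟩ := key α₂ (by simp)
  have hd : α₁ - α₂ ≠ 0 := sub_ne_zero.mpr hα
  have c1 : C121 = 0 := by
    have : C121 * (α₁ - α₂) = 0 := by linarith
    exact (mul_eq_zero.mp this).resolve_right hd
  have c2 : C221 = 0 := by
    have : C221 * (α₁ - α₂) = 0 := by linarith
    exact (mul_eq_zero.mp this).resolve_right hd
  subst hρ11 hρ12 hρ21 hρ22 c1 c2
  have c3 : μ * C222 = 0 := by linarith
  refine ⟨rfl, rfl, c3, fun α hm => ?_⟩
  have h := (key α hm).1
  linear_combination h + C112 * c3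
end

section
/- Consider the connection on ℝ² with constant Christoffel symbols Γ_{11}^1 = −1, Γ_{12}^1 = Γ_{21}^1 = 1, Γ_{22}^2 = 2 and all other Γ_{ij}^k = 0 (the Type A model M₁, whose symmetric Ricci tensor is ρ_s = dx²⊗dx²). The set of smooth f : ℝ² → ℝ satisfying (Hf)₁₁ = 0, (Hf)₁₂ = 0 and (Hf)₂₂ = −f on ℝ² (i.e., the affine quasi-Einstein equation with μ = −1) is exactly the real span of the three functions e^{−x¹+x²}, e^{x²}, and x²·e^{x²}. -/
noncomputable def FF (a b c : ℝ) : ℝ × ℝ → ℝ := fun p =>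
  a * Real.exp (-p.1 + p.2) + b * Real.exp p.2 + c * (p.2 * Real.exp p.2)

lemma hasF (a b c : ℝ) (p : ℝ × ℝ) : HasFDerivAt (FF a b c)
    ((-(a * Real.exp (-p.1 + p.2))) • ContinuousLinearMap.fst ℝ ℝ ℝ +
      (FF a (b + c) c p) • ContinuousLinearMap.snd ℝ ℝ ℝ) p := by
  have h1 : HasFDerivAt (fun p : ℝ × ℝ => p.1) (ContinuousLinearMap.fst ℝ ℝ ℝ) p := hasFDerivAt_fst
  have h2 : HasFDerivAt (fun p : ℝ × ℝ => p.2) (ContinuousLinearMap.snd ℝ ℝ ℝ) p := hasFDerivAt_snd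
  have := (((h1.fun_neg.fun_add h2).exp.const_mul a).fun_add (h2.exp.const_mul b)).fun_add
    ((h2.fun_mul h2.exp).const_mul c)
  refine this.congr_fderiv ?_
  ext <;> simp [FF] <;> ring

lemma pd1F (a b c : ℝ) : pd1 (FF a b c) = FF (-a) 0 0 := by
  funext p
  simp [pd1, (hasF a b c p).fderiv, FF]

lemma pd2F (a b c : ℝ) : pd2 (FF a b c) = FF a (b + c) c := by
  funext p
  simp [pd2, (hasF a b c p).fderiv]

lemma const_of (F : ℝ × ℝ → ℝ) (hF : Differentiable ℝ F) (h1 : ∀ p, pd1 F p = 0)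
    (h2 : ∀ p, pd2 F p = 0) (p : ℝ × ℝ) : F p = F 0 := by
  refine is_const_of_fderiv_eq_zero (𝕜 := ℝ) hF (fun q => ?_) p 0
  ext
  · simpa [pd1] using h1 q
  · simpa [pd2] using h2 q

lemma symm_pd (f : ℝ × ℝ → ℝ) (hf : ContDiff ℝ (⊤ : ℕ∞) f) (p : ℝ × ℝ) :
    pd2 (pd1 f) p = pd1 (pd2 f) p := by
  have hd : DifferentiableAt ℝ (fderiv ℝ f) p :=
    ((hf.fderiv_right (m := 1) (by norm_cast)).differentiable (by norm_num)) p
  have hs : IsSymmSndFDerivAt ℝ f p :=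
    hf.contDiffAt.isSymmSndFDerivAt (by simp;  norm_cast)
  have e (v w : ℝ × ℝ) : fderiv ℝ (fun q => fderiv ℝ f q v) p w = fderiv ℝ (fderiv ℝ f) p w v := by
    rw [(hd.hasFDerivAt.clm_apply (hasFDerivAt_const v p)).fderiv]
    simp
  unfold pd1 pd2
  rw [e, e]
  exact hs _ _

/-- For the Type A model M₁ (Γ₁₁¹ = −1, Γ₁₂¹ = 1, Γ₂₂² = 2, others zero, ρ_s = dx²⊗dx²),
the smooth solutions of the affine quasi-Einstein equation with μ = −1 are exactly the
span of e^{−x¹+x²}, e^{x²} and x²e^{x²}. -/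
theorem stmt3 (f : ℝ × ℝ → ℝ) :
    (ContDiff ℝ (⊤ : ℕ∞) f ∧
      ∀ p : ℝ × ℝ,
        pd1 (pd1 f) p - (-1) * pd1 f p - 0 * pd2 f p = 0 ∧
        pd1 (pd2 f) p - 1 * pd1 f p - 0 * pd2 f p = 0 ∧
        pd2 (pd2 f) p - 0 * pd1 f p - 2 * pd2 f p = -(f p)) ↔
    (∃ a b c : ℝ, ∀ p : ℝ × ℝ,
      f p = a * Real.exp (-p.1 + p.2) + b * Real.exp p.2 + c * (p.2 * Real.exp p.2)) := by
  constructor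
  · rintro ⟨hf, h⟩
    have hfd : Differentiable ℝ f := hf.differentiable (by simp)
    have hd : Differentiable ℝ (fderiv ℝ f) :=
      (hf.fderiv_right (m := 1) (by norm_cast)).differentiable (by norm_num)
    have d1 : Differentiable ℝ (pd1 f) := hd.clm_apply (differentiable_const _)
    have d2 : Differentiable ℝ (pd2 f) := hd.clm_apply (differentiable_const _)
    have e11 p : pd1 (pd1 f) p = - pd1 f p := by linarith [(h p).1]
    have e12 p : pd1 (pd2 f) p = pd1 f p := by linarith [(h p).2.1]
    have e21 p : pd2 (pd1 f) p = pd1 f p := by rw [symm_pd f hf, e12]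
    have e22 p : pd2 (pd2 f) p = 2 * pd2 f p - f p := by linarith [(h p).2.2]
    have h1 p : HasFDerivAt (fun p : ℝ × ℝ => p.1) (ContinuousLinearMap.fst ℝ ℝ ℝ) p :=
      hasFDerivAt_fst
    have h2 p : HasFDerivAt (fun p : ℝ × ℝ => p.2) (ContinuousLinearMap.snd ℝ ℝ ℝ) p :=
      hasFDerivAt_snd
    have g0 p := (hfd p).hasFDerivAt
    have g1 p := (d1 p).hasFDerivAt
    have g2 p := (d2 p).hasFDerivAt
    have hC p := (h2 p).fun_neg.exp.fun_mul ((g2 p).fun_sub (g0 p))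
    have hA p := ((h1 p).fun_sub (h2 p)).exp.fun_mul (g1 p)
    have hB p := ((h2 p).fun_neg.exp.fun_mul ((g0 p).fun_add (g1 p))).fun_sub
      ((h2 p).fun_mul (hC p))
    have cC := const_of _ (fun p => (hC p).differentiableAt)
      (fun p => by
        have a1 := e12 p
        change fderiv ℝ _ p (1, 0) = 0
        rw [(hC p).fderiv]
        simp [pd1, pd2] at a1 ⊢
        linear_combination a1)
      (fun p => by
        have a1 := e22 p
        change fderiv ℝ _ p (0, 1) = 0
        rw [(hC p).fderiv]
        simp [pd1, pd2] at a1 ⊢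
        linear_combination Real.exp (-p.2) * a1)
    have cA := const_of _ (fun p => (hA p).differentiableAt)
      (fun p => by
        have a1 := e11 p
        change fderiv ℝ _ p (1, 0) = 0
        rw [(hA p).fderiv]
        simp [pd1, pd2] at a1 ⊢
        linear_combination Real.exp (p.1-p.2) * a1)
      (fun p => by
        have a1 := e21 p
        change fderiv ℝ _ p (0, 1) = 0
        rw [(hA p).fderiv]
        simp [pd1, pd2] at a1 ⊢
        linear_combination Real.exp (p.1-p.2) * a1)
    have cB := const_of _ (fun p => (hB p).differentiableAt)
      (fun p => by
        have a1 := e11 p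
        have a2 := e12 p
        change fderiv ℝ _ p (1, 0) = 0
        rw [(hB p).fderiv]
        simp [pd1, pd2] at a1 a2 ⊢
        linear_combination Real.exp (-p.2) * a1 - p.2 * Real.exp (-p.2) * a2)
      (fun p => by
        have a1 := e21 p
        have a2 := e22 p
        change fderiv ℝ _ p (0, 1) = 0
        rw [(hB p).fderiv]
        simp [pd1, pd2] at a1 a2 ⊢
        linear_combination Real.exp (-p.2) * a1 - p.2 * Real.exp (-p.2) * a2)
    refine ⟨-pd1 f 0, f 0 + pd1 f 0, pd2 f 0 - f 0, fun p => ?_⟩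
    have kC := cC p
    have kA := cA p
    have kB := cB p
    simp at kC kA kB
    have x1 : Real.exp (-p.2) * Real.exp p.2 = 1 := by rw [← Real.exp_add]; simp
    have x2 : Real.exp (p.1 - p.2) * Real.exp (-p.1 + p.2) = 1 := by
      rw [← Real.exp_add]; simp
    rw [kC] at kB
    linear_combination Real.exp p.2 * kB - Real.exp (-p.1 + p.2) * kA
      - (f p + pd1 f p) * x1 + pd1 f p * x2
  · rintro ⟨a, b, c, h⟩
    obtain rfl : f = FF a b c := funext h
    refine ⟨by unfold FF; fun_prop, fun p => ?_⟩
    simp only [pd1F, pd2F]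
    refine ⟨?_, ?_, ?_⟩ <;> simp only [FF] <;> ring
end

section
/- Consider the connection on ℝ² with constant Christoffel symbols Γ_{11}^1 = −1, Γ_{12}^1 = Γ_{21}^1 = 1, Γ_{22}^2 = 2 and all other Γ_{ij}^k = 0 (the Type A model M₁, whose symmetric Ricci tensor is ρ_s = dx²⊗dx²). For every real μ with μ > −1, the set of smooth f : ℝ² → ℝ satisfying (Hf)₁₁ = 0, (Hf)₁₂ = 0 and (Hf)₂₂ = μ·f on ℝ² is exactly the real span of the two functions e^{(1−√(1+μ))x²} and e^{(1+√(1+μ))x²}. -/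
lemma pd_snd (φ : ℝ → ℝ) (d : ℝ) (p : ℝ × ℝ) (h : HasDerivAt φ d p.2) :
    pd1 (fun q => φ q.2) p = 0 ∧ pd2 (fun q => φ q.2) p = d := by
  have h1 : HasFDerivAt (fun q : ℝ × ℝ => φ q.2) (d • ContinuousLinearMap.snd ℝ ℝ ℝ) p :=
    h.comp_hasFDerivAt p hasFDerivAt_snd
  constructor <;> simp [pd1, pd2, h1.fderiv]

lemma pd1_smooth {f : ℝ × ℝ → ℝ} (h : ContDiff ℝ (⊤ : ℕ∞) f) : ContDiff ℝ (⊤ : ℕ∞) (pd1 f) :=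
  (h.fderiv_right (m := (⊤ : ℕ∞)) (by simp)).clm_apply contDiff_const

lemma pd2_smooth {f : ℝ × ℝ → ℝ} (h : ContDiff ℝ (⊤ : ℕ∞) f) : ContDiff ℝ (⊤ : ℕ∞) (pd2 f) :=
  (h.fderiv_right (m := (⊤ : ℕ∞)) (by simp)).clm_apply contDiff_const

lemma pd_comm {f : ℝ × ℝ → ℝ} (h : ContDiff ℝ (⊤ : ℕ∞) f) (p : ℝ × ℝ) :
    pd1 (pd2 f) p = pd2 (pd1 f) p := by
  have hs : IsSymmSndFDerivAt ℝ f p :=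
    h.contDiffAt.isSymmSndFDerivAt (by simp; exact WithTop.coe_le_coe.mpr (le_top : (2 : ℕ∞) ≤ ⊤))
  have hd : DifferentiableAt ℝ (fderiv ℝ f) p :=
    ((h.fderiv_right (m := (⊤ : ℕ∞)) (by simp)).differentiable (by simp)) p
  have e : ∀ v w : ℝ × ℝ, fderiv ℝ (fun q => fderiv ℝ f q v) p w = fderiv ℝ (fderiv ℝ f) p w v := by
    intro v w
    rw [fderiv_clm_apply hd (differentiableAt_const v)]
    simp
  unfold pd1 pd2
  rw [e, e]
  exact hs _ _

lemma hd1 {f : ℝ × ℝ → ℝ} (h : ContDiff ℝ (⊤ : ℕ∞) f) (x y : ℝ) :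
    HasDerivAt (fun x => f (x, y)) (pd1 f (x, y)) x :=
  ((h.differentiable (by simp)) (x, y)).hasFDerivAt.comp_hasDerivAt x
    ((hasDerivAt_id x).prodMk (hasDerivAt_const x y))

lemma hd2 {f : ℝ × ℝ → ℝ} (h : ContDiff ℝ (⊤ : ℕ∞) f) (x y : ℝ) :
    HasDerivAt (fun y => f (x, y)) (pd2 f (x, y)) y :=
  ((h.differentiable (by simp)) (x, y)).hasFDerivAt.comp_hasDerivAt y
    ((hasDerivAt_const y x).prodMk (hasDerivAt_id y))

lemma first_int (h k : ℝ → ℝ) (r t μ : ℝ) (hs : r + t = 2) (hp : r * t = -μ)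
    (hh : ∀ y, HasDerivAt h (k y) y) (hk : ∀ y, HasDerivAt k (2 * k y + μ * h y) y) (y : ℝ) :
    k y - r * h y = (k 0 - r * h 0) * Real.exp (t * y) := by
  have hD : ∀ y, HasDerivAt (fun y => (k y - r * h y) * Real.exp (-(t * y))) 0 y := by
    intro y
    have h1 := ((hk y).sub ((hh y).const_mul r)).mul (((hasDerivAt_id y).const_mul t).neg.exp)
    refine h1.congr_deriv ?_
    have e2 : μ = -(r * t) := by linarith
    have e3 : (2 : ℝ) = r + t := hs.symm
    simp only [id, e2, Pi.sub_apply]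
    rw [e3]
    simp
    ring
  have hc := is_const_of_deriv_eq_zero (fun y => (hD y).differentiableAt)
    (fun y => (hD y).deriv) y 0
  simp only [mul_zero, neg_zero, Real.exp_zero, mul_one] at hc
  rw [← hc, mul_assoc, ← Real.exp_add]
  simp

/-- For the Type A model M₁ (Γ₁₁¹ = −1, Γ₁₂¹ = 1, Γ₂₂² = 2, others zero, ρ_s = dx²⊗dx²)
and any μ > −1, the smooth solutions of the affine quasi-Einstein equation with
eigenvalue μ are exactly the span of e^{(1−√(1+μ))x²} and e^{(1+√(1+μ))x²}. -/
theorem stmt4 (μ : ℝ) (hμ : -1 < μ) (f : ℝ × ℝ → ℝ) :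
    (ContDiff ℝ (⊤ : ℕ∞) f ∧
      ∀ p : ℝ × ℝ,
        pd1 (pd1 f) p - (-1) * pd1 f p - 0 * pd2 f p = 0 ∧
        pd1 (pd2 f) p - 1 * pd1 f p - 0 * pd2 f p = 0 ∧
        pd2 (pd2 f) p - 0 * pd1 f p - 2 * pd2 f p = μ * f p) ↔
    (∃ a b : ℝ, ∀ p : ℝ × ℝ,
      f p = a * Real.exp ((1 - Real.sqrt (1 + μ)) * p.2)
          + b * Real.exp ((1 + Real.sqrt (1 + μ)) * p.2)) := by
  set s := Real.sqrt (1 + μ) with hsdef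
  have hs2 : s * s = 1 + μ := Real.mul_self_sqrt (by linarith)
  have hs0 : 0 < s := Real.sqrt_pos.mpr (by linarith)
  have hE : ∀ c y : ℝ, HasDerivAt (fun y => Real.exp (c * y)) (c * Real.exp (c * y)) y := by
    intro c y
    exact (((hasDerivAt_id y).const_mul c).exp).congr_deriv (by simp; ring)
  have hT : ∀ a b y : ℝ, HasDerivAt
      (fun y => a * Real.exp ((1 - s) * y) + b * Real.exp ((1 + s) * y))
      ((a * (1 - s)) * Real.exp ((1 - s) * y) + (b * (1 + s)) * Real.exp ((1 + s) * y)) y := by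
    intro a b y
    exact (((hE (1 - s) y).const_mul a).add ((hE (1 + s) y).const_mul b)).congr_deriv (by ring)
  constructor
  · rintro ⟨hf, H⟩
    have hF1 := pd1_smooth hf
    have hF2 := pd2_smooth hf
    have e12 : pd1 (pd2 f) = pd1 f := by
      funext p; linarith [(H p).2.1]
    have e21 : pd2 (pd1 f) = pd1 f := by
      funext p; rw [← pd_comm hf p, e12]
    have e22 : pd2 (pd2 f) = fun p => 2 * pd2 f p + μ * f p := by
      funext p; linarith [(H p).2.2]
    have z : ∀ p, pd1 f p = 0 := by
      rintro ⟨x, y⟩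
      have h1 := hd1 (pd2_smooth hF2) x y
      rw [pd_comm hF2, e12, e21, e22] at h1
      have h2 := ((hd1 hF2 x y).const_mul 2).add ((hd1 hf x y).const_mul μ)
      have h3 := h1.unique h2
      rw [e12] at h3
      have h4 : (1 + μ) * pd1 f (x, y) = 0 := by linarith
      rcases mul_eq_zero.mp h4 with h | h
      · linarith
      · exact h
    have hc : ∀ x y, f (x, y) = f (0, y) := fun x y =>
      is_const_of_deriv_eq_zero (f := fun x => f (x, y))
        (fun x => (hd1 hf x y).differentiableAt)
        (fun x => by rw [(hd1 hf x y).deriv, z]) x 0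
    have hh : ∀ y, HasDerivAt (fun y => f (0, y)) (pd2 f (0, y)) y := fun y => hd2 hf 0 y
    have hk : ∀ y, HasDerivAt (fun y => pd2 f (0, y)) (2 * pd2 f (0, y) + μ * f (0, y)) y := by
      intro y
      have h := hd2 hF2 0 y
      rwa [e22] at h
    have A := first_int _ _ (1 - s) (1 + s) μ (by ring) (by linarith) hh hk
    have B := first_int _ _ (1 + s) (1 - s) μ (by ring) (by linarith) hh hk
    refine ⟨-(pd2 f (0, 0) - (1 + s) * f (0, 0)) / (2 * s),
      (pd2 f (0, 0) - (1 - s) * f (0, 0)) / (2 * s), ?_⟩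
    rintro ⟨x, y⟩
    rw [hc]
    have a := A y
    have b := B y
    simp only at a b ⊢
    field_simp
    linarith
  · rintro ⟨a, b, h⟩
    obtain rfl : f = fun p => a * Real.exp ((1 - s) * p.2) + b * Real.exp ((1 + s) * p.2) :=
      funext h
    refine ⟨by fun_prop, ?_⟩
    have E1 : ∀ a b : ℝ, pd1 (fun p => a * Real.exp ((1 - s) * p.2) + b * Real.exp ((1 + s) * p.2))
        = fun _ => 0 := fun a b => funext fun p => (pd_snd _ _ p (hT a b p.2)).1
    have E2 : ∀ a b : ℝ, pd2 (fun p => a * Real.exp ((1 - s) * p.2) + b * Real.exp ((1 + s) * p.2))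
        = fun p => (a * (1 - s)) * Real.exp ((1 - s) * p.2)
          + (b * (1 + s)) * Real.exp ((1 + s) * p.2) :=
      fun a b => funext fun p => (pd_snd _ _ p (hT a b p.2)).2
    have E0 : pd1 (fun _ => (0 : ℝ)) = fun _ => 0 := by
      funext p; simp [pd1]
    intro p
    simp only [E1, E2, E0]
    have hm : μ = s * s - 1 := by linarith
    refine ⟨by ring, by ring, ?_⟩
    rw [hm]
    ring
end

section
/- Let c ∈ ℝ with c² + c ≠ 0. Consider the connection on ℝ² with constant Christoffel symbols Γ_{11}^1 = −1, Γ_{12}^1 = Γ_{21}^1 = c, Γ_{22}^2 = 1+2c and all other Γ_{ij}^k = 0 (the Type A model M₂^c, whose symmetric Ricci tensor is ρ_s = (c²+c)·dx²⊗dx²). The set of smooth f : ℝ² → ℝ satisfying (Hf)₁₁ = 0, (Hf)₁₂ = 0 and (Hf)₂₂ = −(c²+c)·f on ℝ² (the affine quasi-Einstein equation with μ = −1) is exactly the real span of the three functions e^{c x²}, e^{(1+c)x²}, and e^{−x¹+c x²}. -/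
lemma aux_pd1 {F : ℝ × ℝ → ℝ} (hF : Differentiable ℝ F) (x y : ℝ) :
    HasDerivAt (fun t => F (t, y)) (pd1 F (x, y)) x := by
  have h1 : HasDerivAt (fun t : ℝ => (t, y)) ((1 : ℝ), (0 : ℝ)) x :=
    (hasDerivAt_id x).prodMk (hasDerivAt_const x y)
  exact (hF (x, y)).hasFDerivAt.comp_hasDerivAt x h1

lemma aux_pd2 {F : ℝ × ℝ → ℝ} (hF : Differentiable ℝ F) (x y : ℝ) :
    HasDerivAt (fun t => F (x, t)) (pd2 F (x, y)) y := by
  have h1 : HasDerivAt (fun t : ℝ => (x, t)) ((0 : ℝ), (1 : ℝ)) y :=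
    (hasDerivAt_const y x).prodMk (hasDerivAt_id y)
  exact (hF (x, y)).hasFDerivAt.comp_hasDerivAt y h1

lemma aux_exp (k : ℝ) (y : ℝ) :
    HasDerivAt (fun t => Real.exp (k * t)) (k * Real.exp (k * y)) y := by
  have := ((hasDerivAt_id y).const_mul k).exp
  simpa [mul_comm] using this

lemma aux_ode {g : ℝ → ℝ} (k : ℝ) (h : ∀ t, HasDerivAt g (k * g t) t) (t : ℝ) :
    g t = g 0 * Real.exp (k * t) := by
  have h2 : ∀ t, HasDerivAt (fun t => g t * Real.exp (-k * t)) 0 t := by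
    intro t
    have := (h t).mul (aux_exp (-k) t)
    have hh := this
    refine hh.congr_deriv ?_
    try beta_reduce
    ring
  have h3 := is_const_of_deriv_eq_zero (fun t => (h2 t).differentiableAt)
    (fun t => (h2 t).deriv) t 0
  simp only [mul_zero, Real.exp_zero, mul_one] at h3
  rw [← h3, mul_assoc, ← Real.exp_add]
  simp

/-- the general element of the span -/
noncomputable def auxG (c a b d : ℝ) : ℝ × ℝ → ℝ := fun p =>
  a * Real.exp (c * p.2) + b * Real.exp ((1 + c) * p.2) + d * Real.exp (-p.1 + c * p.2)

lemma auxG_contDiff (c a b d : ℝ) : ContDiff ℝ (⊤ : ℕ∞) (auxG c a b d) := by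
  unfold auxG; fun_prop

lemma auxG_pd1 (c a b d : ℝ) : pd1 (auxG c a b d) = auxG c 0 0 (-d) := by
  funext ⟨x, y⟩
  have h := aux_pd1 ((auxG_contDiff c a b d).differentiable (by simp)) x y
  refine h.unique ?_
  have h1 := ((((hasDerivAt_id x).neg.add_const (c * y)).exp).const_mul d).const_add
    (a * Real.exp (c * y) + b * Real.exp ((1 + c) * y))
  have hh := h1
  refine hh.congr_deriv ?_
  try beta_reduce
  simp only [auxG, id, Pi.neg_apply]
  ring

lemma auxG_pd2 (c a b d : ℝ) :
    pd2 (auxG c a b d) = auxG c (c * a) ((1 + c) * b) (c * d) := by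
  funext ⟨x, y⟩
  have h := aux_pd2 ((auxG_contDiff c a b d).differentiable (by simp)) x y
  refine h.unique ?_
  have h1 := (((aux_exp c y).const_mul a).add ((aux_exp (1 + c) y).const_mul b)).add
    (((((hasDerivAt_id y).const_mul c).const_add (-x)).exp).const_mul d)
  have hh := h1
  refine hh.congr_deriv ?_
  try beta_reduce
  simp only [auxG, id]
  ring

/-- For the Type A model M₂^c (Γ₁₁¹ = −1, Γ₁₂¹ = c, Γ₂₂² = 1+2c, others zero,
ρ_s = (c²+c)dx²⊗dx², with c²+c ≠ 0), the smooth solutions of the affine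
quasi-Einstein equation with μ = −1 are exactly the span of e^{cx²}, e^{(1+c)x²}
and e^{−x¹+cx²}. -/
theorem stmt5 (c : ℝ) (hc : c ^ 2 + c ≠ 0) (f : ℝ × ℝ → ℝ) :
    (ContDiff ℝ (⊤ : ℕ∞) f ∧
      ∀ p : ℝ × ℝ,
        pd1 (pd1 f) p - (-1) * pd1 f p - 0 * pd2 f p = 0 ∧
        pd1 (pd2 f) p - c * pd1 f p - 0 * pd2 f p = 0 ∧
        pd2 (pd2 f) p - 0 * pd1 f p - (1 + 2 * c) * pd2 f p = -((c ^ 2 + c) * f p)) ↔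
    (∃ a b d : ℝ, ∀ p : ℝ × ℝ,
      f p = a * Real.exp (c * p.2) + b * Real.exp ((1 + c) * p.2)
          + d * Real.exp (-p.1 + c * p.2)) := by
  constructor
  · rintro ⟨hf, H⟩
    have hd : Differentiable ℝ f := hf.differentiable (by simp)
    have hf' : ContDiff ℝ 1 (fderiv ℝ f) := hf.fderiv_right (by norm_cast)
    have hu : Differentiable ℝ (pd1 f) :=
      (hf'.clm_apply contDiff_const).differentiable (by simp)
    have hv : Differentiable ℝ (pd2 f) :=
      (hf'.clm_apply contDiff_const).differentiable (by simp)
    obtain ⟨b, hb⟩ : ∃ b, b = pd2 f (0, 0) - c * f (0, 0) := ⟨_, rfl⟩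
    obtain ⟨A, hA⟩ : ∃ A, A = pd1 f (0, 0) + f (0, 0) := ⟨_, rfl⟩
    have w0 : ∀ x y, pd2 f (x, y) - c * f (x, y) = b * Real.exp ((1 + c) * y) := by
      intro x y
      have e1 := aux_ode (g := fun t => pd2 f (t, 0) - c * f (t, 0)) 0 (fun t => by
        have hh := (aux_pd1 hv t 0).sub ((aux_pd1 hd t 0).const_mul c)
        refine hh.congr_deriv ?_
        try beta_reduce
        linarith [(H (t, 0)).2.1]) x
      have e2 := aux_ode (g := fun t => pd2 f (x, t) - c * f (x, t)) (1 + c) (fun t => by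
        have hh := (aux_pd2 hv x t).sub ((aux_pd2 hd x t).const_mul c)
        refine hh.congr_deriv ?_
        try beta_reduce
        linarith [(H (x, t)).2.2]) y
      simp only [zero_mul, Real.exp_zero, mul_one] at e1
      rw [e2, e1, hb]
    have f0 : ∀ x, f (x, 0) = A + (f (0, 0) - A) * Real.exp (-x) := by
      intro x
      have s : ∀ x, pd1 f (x, 0) + f (x, 0) = A := by
        intro x
        have e1 := aux_ode (g := fun t => pd1 f (t, 0) + f (t, 0)) 0 (fun t => by
          have hh := (aux_pd1 hu t 0).add (aux_pd1 hd t 0)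
          refine hh.congr_deriv ?_
          try beta_reduce
          linarith [(H (t, 0)).1]) x
        simp only [zero_mul, Real.exp_zero, mul_one] at e1
        rw [e1, hA]
      have e2 := aux_ode (g := fun t => f (t, 0) - A) (-1) (fun t => by
        have hh := (aux_pd1 hd t 0).sub_const A
        refine hh.congr_deriv ?_
        try beta_reduce
        linarith [s t]) x
      simp only [neg_mul, one_mul] at e2
      linarith
    refine ⟨A - b, b, f (0, 0) - A, ?_⟩
    rintro ⟨x, y⟩
    have e := aux_ode (g := fun t => f (x, t) - b * Real.exp ((1 + c) * t)) c (fun t => by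
      have hh := (aux_pd2 hd x t).sub ((aux_exp (1 + c) t).const_mul b)
      refine hh.congr_deriv ?_
      try beta_reduce
      linarith [w0 x t]) y
    simp only [mul_zero, Real.exp_zero, mul_one] at e
    rw [f0 x] at e
    simp only [Real.exp_add]
    linear_combination e
  · rintro ⟨a, b, d, h⟩
    obtain rfl : f = auxG c a b d := funext h
    refine ⟨auxG_contDiff c a b d, fun p => ?_⟩
    simp only [auxG_pd1, auxG_pd2]
    simp only [auxG]
    refine ⟨?_, ?_, ?_⟩ <;> ring
end

section
/- Let c ∈ ℝ. Consider the connection on ℝ² with constant Christoffel symbols Γ_{11}^1 = −1, Γ_{12}^1 = Γ_{21}^1 = c, Γ_{22}^1 = −1, Γ_{22}^2 = 2c and all other Γ_{ij}^k = 0 (the Type A model M₅^c, whose symmetric Ricci tensor is ρ_s = (1+c²)·dx²⊗dx²). The set of smooth f : ℝ² → ℝ satisfying (Hf)₁₁ = 0, (Hf)₁₂ = 0 and (Hf)₂₂ = −(1+c²)·f on ℝ² (the affine quasi-Einstein equation with μ = −1) is exactly the real span of the three functions e^{−x¹+c x²}, e^{c x²}·cos(x²), and e^{c x²}·sin(x²).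 -/
theorem two_le_smooth : (2 : WithTop ℕ∞) ≤ ((⊤ : ℕ∞) : WithTop ℕ∞) :=
  WithTop.coe_le_coe.2 (le_top : (2 : ℕ∞) ≤ ⊤)

theorem pd_of_has {f : ℝ × ℝ → ℝ} {a b : ℝ} {p : ℝ × ℝ}
    (h : HasFDerivAt f (a • ContinuousLinearMap.fst ℝ ℝ ℝ + b • ContinuousLinearMap.snd ℝ ℝ ℝ) p) :
    pd1 f p = a ∧ pd2 f p = b := by
  constructor <;> simp [pd1, pd2, h.fderiv]

theorem has_of_diff {f : ℝ × ℝ → ℝ} {p : ℝ × ℝ} (h : DifferentiableAt ℝ f p) :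
    HasFDerivAt f (pd1 f p • ContinuousLinearMap.fst ℝ ℝ ℝ
      + pd2 f p • ContinuousLinearMap.snd ℝ ℝ ℝ) p := by
  convert h.hasFDerivAt using 1
  ext <;> simp [pd1, pd2]

theorem has_gen (c a b d : ℝ) (p : ℝ × ℝ) :
    HasFDerivAt (fun p : ℝ × ℝ => a * Real.exp (-p.1 + c * p.2)
          + b * (Real.exp (c * p.2) * Real.cos p.2)
          + d * (Real.exp (c * p.2) * Real.sin p.2))
      ((-a * Real.exp (-p.1 + c * p.2)) • ContinuousLinearMap.fst ℝ ℝ ℝ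
      + ((c * a) * Real.exp (-p.1 + c * p.2)
          + (c * b + d) * (Real.exp (c * p.2) * Real.cos p.2)
          + (c * d - b) * (Real.exp (c * p.2) * Real.sin p.2)) • ContinuousLinearMap.snd ℝ ℝ ℝ) p := by
  have h1 : HasFDerivAt (fun p : ℝ × ℝ => p.1) (ContinuousLinearMap.fst ℝ ℝ ℝ) p := hasFDerivAt_fst
  have h2 : HasFDerivAt (fun p : ℝ × ℝ => p.2) (ContinuousLinearMap.snd ℝ ℝ ℝ) p := hasFDerivAt_snd
  have e1 := (h1.neg.add (h2.const_mul c)).exp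
  have e2 := (h2.const_mul c).exp
  have := ((e1.const_mul a).add ((e2.mul h2.cos).const_mul b)).add ((e2.mul h2.sin).const_mul d)
  refine this.congr_fderiv ?_
  ext <;> simp <;> ring

theorem const_of_has {F : ℝ × ℝ → ℝ}
    (h : ∀ p, HasFDerivAt F (0 : ℝ × ℝ →L[ℝ] ℝ) p) : ∃ A, ∀ p, F p = A :=
  ⟨F 0, fun p => is_const_of_fderiv_eq_zero (𝕜 := ℝ) (fun p => (h p).differentiableAt) (fun p => (h p).fderiv) p 0⟩

theorem pd_symm {f : ℝ × ℝ → ℝ} (hf : ContDiff ℝ (⊤ : ℕ∞) f) (p : ℝ × ℝ) :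
    pd2 (pd1 f) p = pd1 (pd2 f) p := by
  have hs : IsSymmSndFDerivAt ℝ f p :=
    hf.contDiffAt.isSymmSndFDerivAt (by simpa using two_le_smooth)
  have hd : DifferentiableAt ℝ (fderiv ℝ f) p :=
    ((hf.fderiv_right (m := 1) (by rw [one_add_one_eq_two]; exact two_le_smooth)).differentiable (by simp)) p
  have := hs.eq (0, 1) (1, 0)
  unfold pd1 pd2
  rw [fderiv_clm_apply hd (by fun_prop), fderiv_clm_apply hd (by fun_prop)]
  simpa using this

/-- For the Type A model M₅^c (Γ₁₁¹ = −1, Γ₁₂¹ = c, Γ₂₂¹ = −1, Γ₂₂² = 2c, others zero,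
ρ_s = (1+c²)dx²⊗dx²), the smooth solutions of the affine quasi-Einstein equation with
μ = −1 are exactly the span of e^{−x¹+cx²}, e^{cx²}cos x² and e^{cx²}sin x². -/
theorem stmt7 (c : ℝ) (f : ℝ × ℝ → ℝ) :
    (ContDiff ℝ (⊤ : ℕ∞) f ∧
      ∀ p : ℝ × ℝ,
        pd1 (pd1 f) p - (-1) * pd1 f p - 0 * pd2 f p = 0 ∧
        pd1 (pd2 f) p - c * pd1 f p - 0 * pd2 f p = 0 ∧
        pd2 (pd2 f) p - (-1) * pd1 f p - (2 * c) * pd2 f p = -((1 + c ^ 2) * f p)) ↔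
    (∃ a b d : ℝ, ∀ p : ℝ × ℝ,
      f p = a * Real.exp (-p.1 + c * p.2)
          + b * (Real.exp (c * p.2) * Real.cos p.2)
          + d * (Real.exp (c * p.2) * Real.sin p.2)) := by
  constructor
  · rintro ⟨hf, he⟩
    have hfd : Differentiable ℝ f := hf.differentiable (by simp)
    have hF : ContDiff ℝ 1 (fderiv ℝ f) := hf.fderiv_right (m := 1) (by rw [one_add_one_eq_two]; exact two_le_smooth)
    have hu : Differentiable ℝ (pd1 f) :=
      (hF.clm_apply contDiff_const).differentiable (by simp)
    have hv : Differentiable ℝ (pd2 f) :=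
      (hF.clm_apply contDiff_const).differentiable (by simp)
    have f' := fun p => has_of_diff (hfd p)
    have u' := fun p => has_of_diff (hu p)
    have v' := fun p => has_of_diff (hv p)
    have e11 : ∀ p, pd1 (pd1 f) p = - pd1 f p := fun p => by linarith [(he p).1]
    have e12 : ∀ p, pd1 (pd2 f) p = c * pd1 f p := fun p => by linarith [(he p).2.1]
    have e22 : ∀ p, pd2 (pd2 f) p = - pd1 f p + 2 * c * pd2 f p - (1 + c ^ 2) * f p :=
      fun p => by linarith [(he p).2.2]
    have e21 : ∀ p, pd2 (pd1 f) p = c * pd1 f p := fun p => by rw [pd_symm hf, e12]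
    simp only [e11, e12, e22, e21] at u' v'
    have h1 : ∀ p, HasFDerivAt (fun p : ℝ × ℝ => p.1) (ContinuousLinearMap.fst ℝ ℝ ℝ) p :=
      fun p => hasFDerivAt_fst
    have h2 : ∀ p, HasFDerivAt (fun p : ℝ × ℝ => p.2) (ContinuousLinearMap.snd ℝ ℝ ℝ) p :=
      fun p => hasFDerivAt_snd
    obtain ⟨A, hA⟩ := const_of_has (F := fun p => Real.exp (p.1 + -c * p.2) * pd1 f p) (fun p => by
      refine ((((h1 p).add ((h2 p).const_mul (-c))).exp).mul (u' p)).congr_fderiv ?_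
      ext <;> simp <;> ring)
    obtain ⟨B, hB⟩ := const_of_has (F := fun p => Real.exp (-c * p.2) *
        ((f p + pd1 f p) * Real.cos p.2 - (pd2 f p - c * f p) * Real.sin p.2)) (fun p => by
      refine ((((h2 p).const_mul (-c)).exp).mul ((((f' p).add (u' p)).mul (h2 p).cos).sub
        (((v' p).sub ((f' p).const_mul c)).mul (h2 p).sin))).congr_fderiv ?_
      ext <;> simp <;> ring)
    obtain ⟨D, hD⟩ := const_of_has (F := fun p => Real.exp (-c * p.2) *
        ((f p + pd1 f p) * Real.sin p.2 + (pd2 f p - c * f p) * Real.cos p.2)) (fun p => by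
      refine ((((h2 p).const_mul (-c)).exp).mul ((((f' p).add (u' p)).mul (h2 p).sin).add
        (((v' p).sub ((f' p).const_mul c)).mul (h2 p).cos))).congr_fderiv ?_
      ext <;> simp <;> ring)
    refine ⟨-A, B, D, fun p => ?_⟩
    · rw [← hA p, ← hB p, ← hD p]
      have k1 : Real.exp (p.1 + -c * p.2) * Real.exp (-p.1 + c * p.2) = 1 := by
        rw [← Real.exp_add, Real.exp_eq_one_iff]; ring
      have k2 : Real.exp (-c * p.2) * Real.exp (c * p.2) = 1 := by
        rw [← Real.exp_add, Real.exp_eq_one_iff]; ring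
      have k3 := Real.sin_sq_add_cos_sq p.2
      linear_combination (pd1 f p) * k1
        - (f p + pd1 f p) * (Real.sin p.2 ^ 2 + Real.cos p.2 ^ 2) * k2 - (f p + pd1 f p) * k3
  · rintro ⟨a, b, d, h⟩
    obtain rfl : f = _ := funext h
    refine ⟨by fun_prop, fun p => ?_⟩
    have p1 := funext fun p => (pd_of_has (has_gen c a b d p)).1
    have p2 := funext fun p => (pd_of_has (has_gen c a b d p)).2
    have q1 : (fun p : ℝ × ℝ => -a * Real.exp (-p.1 + c * p.2)) =
      (fun p : ℝ × ℝ => (-a) * Real.exp (-p.1 + c * p.2)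
          + 0 * (Real.exp (c * p.2) * Real.cos p.2)
          + 0 * (Real.exp (c * p.2) * Real.sin p.2)) := by ext; ring
    rw [p1, p2, q1, (pd_of_has (has_gen c _ _ _ p)).1, (pd_of_has (has_gen c _ _ _ p)).1,
      (pd_of_has (has_gen c _ _ _ p)).2]
    refine ⟨by ring, by ring, by ring⟩
end

section
/- Let κ ∈ ℝ. Consider the Type B connection on the half-plane {x¹ > 0} with Christoffel symbols Γ_{11}^1 = 2κ/x¹, Γ_{11}^2 = 1/x¹, Γ_{12}^2 = Γ_{21}^2 = κ/x¹ and all other Γ_{ij}^k = 0 (the model Z₁^κ, whose symmetric Ricci tensor is ρ_s = κ(1+κ)(x¹)^{-2}·dx¹⊗dx¹). The set of smooth f on {x¹ > 0} satisfying (Hf)₁₁ = −κ(1+κ)(x¹)^{-2}·f, (Hf)₁₂ = 0 and (Hf)₂₂ = 0 (the affine quasi-Einstein equation with μ = −1) is exactly the real span of the three functions (x¹)^κ, (x¹)^{κ+1}, and (x¹)^κ·(x² + x¹·log x¹). -/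
lemma aux_open : IsOpen {p : ℝ × ℝ | 0 < p.1} := isOpen_lt continuous_const continuous_fst

lemma aux_cd {f : ℝ × ℝ → ℝ} (hf : ContDiffOn ℝ (⊤ : ℕ∞) f {p : ℝ × ℝ | 0 < p.1}) (v : ℝ × ℝ) :
    ContDiffOn ℝ (⊤ : ℕ∞) (fun p => fderiv ℝ f p v) {p : ℝ × ℝ | 0 < p.1} :=
  (hf.fderiv_of_isOpen aux_open (m := (⊤ : ℕ∞)) (by simp)).clm_apply contDiffOn_const

lemma aux_diff {f : ℝ × ℝ → ℝ} (hf : ContDiffOn ℝ (⊤ : ℕ∞) f {p : ℝ × ℝ | 0 < p.1})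
    {x y : ℝ} (hx : 0 < x) : DifferentiableAt ℝ f (x, y) :=
  (hf.differentiableOn (by simp)).differentiableAt (aux_open.mem_nhds hx)

lemma aux_d1 {f : ℝ × ℝ → ℝ} (hf : ContDiffOn ℝ (⊤ : ℕ∞) f {p : ℝ × ℝ | 0 < p.1})
    {x : ℝ} (y : ℝ) (hx : 0 < x) : HasDerivAt (fun t => f (t, y)) (pd1 f (x, y)) x := by
  have h := (aux_diff hf (y := y) hx).hasFDerivAt
  exact h.comp_hasDerivAt (f := fun t : ℝ => (t, y)) x
    ((hasDerivAt_id x).prodMk (hasDerivAt_const x y))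

lemma aux_d2 {f : ℝ × ℝ → ℝ} (hf : ContDiffOn ℝ (⊤ : ℕ∞) f {p : ℝ × ℝ | 0 < p.1})
    {x : ℝ} (y : ℝ) (hx : 0 < x) : HasDerivAt (fun t => f (x, t)) (pd2 f (x, y)) y := by
  have h := (aux_diff hf (y := y) hx).hasFDerivAt
  exact h.comp_hasDerivAt (f := fun t : ℝ => (x, t)) y
    ((hasDerivAt_const y x).prodMk (hasDerivAt_id y))

lemma aux_const {F : ℝ → ℝ} (h : ∀ x, 0 < x → HasDerivAt F 0 x) {x : ℝ} (hx : 0 < x) :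
    F x = F 1 := by
  refine isOpen_Ioi.is_const_of_deriv_eq_zero (s := Set.Ioi (0:ℝ)) isPreconnected_Ioi
    (fun t ht => (h t ht).differentiableAt.differentiableWithinAt)
    (fun t ht => (h t ht).deriv) hx (by simp)

lemma aux_const' {F : ℝ → ℝ} (h : ∀ x, HasDerivAt F 0 x) (x : ℝ) : F x = F 0 :=
  is_const_of_deriv_eq_zero (fun t => (h t).differentiableAt) (fun t => (h t).deriv) x 0

lemma aux_pow (κ : ℝ) {x : ℝ} (hx : 0 < x) :
    HasDerivAt (fun t : ℝ => t ^ κ) (κ * x ^ κ / x) x := by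
  have := Real.hasDerivAt_rpow_const (x := x) (p := κ) (Or.inl hx.ne')
  rwa [Real.rpow_sub_one hx.ne', ← mul_div_assoc] at this

/-- For the Type B model Z₁^κ (Γ₁₁¹ = 2κ/x¹, Γ₁₁² = 1/x¹, Γ₁₂² = κ/x¹, others zero,
ρ_s = κ(1+κ)(x¹)⁻²dx¹⊗dx¹) on the half-plane {x¹ > 0}, the smooth solutions of the
affine quasi-Einstein equation with μ = −1 are exactly the span of (x¹)^κ, (x¹)^{κ+1}
and (x¹)^κ(x² + x¹ log x¹). -/
theorem stmt8 (κ : ℝ) (f : ℝ × ℝ → ℝ) :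
    (ContDiffOn ℝ (⊤ : ℕ∞) f {p : ℝ × ℝ | 0 < p.1} ∧
      ∀ p : ℝ × ℝ, 0 < p.1 →
        pd1 (pd1 f) p - (2 * κ / p.1) * pd1 f p - (1 / p.1) * pd2 f p
          = -(κ * (1 + κ) / p.1 ^ 2) * f p ∧
        pd1 (pd2 f) p - (κ / p.1) * pd2 f p = 0 ∧
        pd2 (pd2 f) p = 0) ↔
    (∃ a b c : ℝ, ∀ p : ℝ × ℝ, 0 < p.1 →
      f p = a * p.1 ^ κ + b * p.1 ^ (κ + 1)
          + c * (p.1 ^ κ * (p.2 + p.1 * Real.log p.1))) := by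
  constructor
  · rintro ⟨hf, he⟩
    have hf1 : ContDiffOn ℝ (⊤ : ℕ∞) (pd1 f) {p : ℝ × ℝ | 0 < p.1} := aux_cd hf _
    have hf2 : ContDiffOn ℝ (⊤ : ℕ∞) (pd2 f) {p : ℝ × ℝ | 0 < p.1} := aux_cd hf _
    have inv : ∀ x : ℝ, 0 < x → x ^ κ * x ^ (-κ) = 1 := fun x hx => by
      rw [← Real.rpow_add hx]; simp
    have s1 : ∀ x y, 0 < x → pd2 f (x, y) = pd2 f (x, 0) := fun x y hx =>
      aux_const' (F := fun t => pd2 f (x, t)) (fun t => by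
        have := aux_d2 hf2 t hx
        rwa [(he (x, t) hx).2.2] at this) y
    obtain ⟨c, hc⟩ : ∃ c, ∀ x, 0 < x → x ^ (-κ) * pd2 f (x, 0) = c :=
      ⟨_, fun x hx => aux_const (F := fun x => x ^ (-κ) * pd2 f (x, 0)) (fun x hx => by
        have h := (aux_pow (-κ) hx).mul (aux_d1 hf2 0 hx)
        refine HasDerivAt.congr_deriv h (Eq.symm ?_)
        have e := (he (x, 0) hx).2.1
        simp only at e
        rw [sub_eq_zero.1 e]
        ring) hx⟩
    have s2 : ∀ x y, 0 < x → pd2 f (x, y) = c * x ^ κ := fun x y hx => by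
      rw [s1 x y hx, ← hc x hx]
      linear_combination (-pd2 f (x, 0)) * inv x hx
    have s3 : ∀ x y, 0 < x → f (x, y) = f (x, 0) + c * x ^ κ * y := fun x y hx => by
      have := aux_const' (F := fun t => f (x, t) - c * x ^ κ * t) (fun t => by
        have := (aux_d2 hf t hx).sub ((hasDerivAt_id t).const_mul (c * x ^ κ))
        refine HasDerivAt.congr_deriv this (Eq.symm ?_)
        rw [s2 x t hx]; simp) y
      linear_combination this
    obtain ⟨A, hA⟩ : ∃ A, ∀ x, 0 < x →
        x ^ (-κ) * (pd1 f (x, 0) - κ * (f (x, 0) / x)) - c * Real.log x = A :=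
      ⟨_, fun x hx => aux_const
        (F := fun x => x ^ (-κ) * (pd1 f (x, 0) - κ * (f (x, 0) / x)) - c * Real.log x)
        (fun x hx => by
        have h := ((aux_pow (-κ) hx).mul ((aux_d1 hf1 0 hx).sub
          (((aux_d1 hf 0 hx).div (hasDerivAt_id x) hx.ne').const_mul κ))).sub
          ((Real.hasDerivAt_log hx.ne').const_mul c)
        refine HasDerivAt.congr_deriv h (Eq.symm ?_)
        have e := (he (x, 0) hx).1
        simp only at e
        rw [s2 x 0 hx] at e
        have e' : pd1 (pd1 f) (x, 0) = -(κ * (1 + κ) / x ^ 2) * f (x, 0)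
          + (2 * κ / x) * pd1 f (x, 0) + (1 / x) * (c * x ^ κ) := by linear_combination e
        rw [e']
        have i := inv x hx
        simp only [id, Pi.sub_apply, Pi.div_apply]
        field_simp
        linear_combination (-c * x) * i) hx⟩
    obtain ⟨B, hB⟩ : ∃ B, ∀ x, 0 < x →
        x ^ (-κ) * f (x, 0) - c * (x * Real.log x - x) - A * x = B :=
      ⟨_, fun x hx => aux_const
        (F := fun x => x ^ (-κ) * f (x, 0) - c * (x * Real.log x - x) - A * x)
        (fun x hx => by
        have h := (((aux_pow (-κ) hx).mul (aux_d1 hf 0 hx)).sub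
          ((((hasDerivAt_id x).mul (Real.hasDerivAt_log hx.ne')).sub
            (hasDerivAt_id x)).const_mul c)).sub ((hasDerivAt_id x).const_mul A)
        refine HasDerivAt.congr_deriv h (Eq.symm ?_)
        rw [← hA x hx]
        simp only [id]
        field_simp
        ring) hx⟩
    refine ⟨B, A - c, c, ?_⟩
    rintro ⟨x, y⟩ hx
    simp only at hx ⊢
    rw [s3 x y hx, Real.rpow_add_one hx.ne', ← hB x hx]
    linear_combination (-f (x, 0)) * inv x hx
  · rintro ⟨a, b, c, h⟩
    have hf : ContDiffOn ℝ (⊤ : ℕ∞) f {p : ℝ × ℝ | 0 < p.1} := by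
      refine ContDiffOn.congr (f := fun p : ℝ × ℝ => a * p.1 ^ κ + b * p.1 ^ (κ + 1)
          + c * (p.1 ^ κ * (p.2 + p.1 * Real.log p.1))) ?_ h
      intro p hp
      have hp' : p.1 ≠ 0 := ne_of_gt hp
      apply ContDiffAt.contDiffWithinAt
      have hr : ∀ r : ℝ, ContDiffAt ℝ (⊤ : ℕ∞) (fun p : ℝ × ℝ => p.1 ^ r) p := fun r =>
        contDiffAt_fst.rpow_const_of_ne hp'
      have hl : ContDiffAt ℝ (⊤ : ℕ∞) (fun p : ℝ × ℝ => Real.log p.1) p :=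
        contDiffAt_fst.log hp'
      exact ((contDiffAt_const.mul (hr _)).add (contDiffAt_const.mul (hr _))).add
        (contDiffAt_const.mul ((hr _).mul (contDiffAt_snd.add (contDiffAt_fst.mul hl))))
    have hf1 : ContDiffOn ℝ (⊤ : ℕ∞) (pd1 f) {p : ℝ × ℝ | 0 < p.1} := aux_cd hf _
    have hf2 : ContDiffOn ℝ (⊤ : ℕ∞) (pd2 f) {p : ℝ × ℝ | 0 < p.1} := aux_cd hf _
    have h0 : ∀ x y, 0 < x → f (x, y) = x ^ κ * (a + b * x + c * (y + x * Real.log x)) :=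
      fun x y hx => by
        rw [h (x, y) hx, Real.rpow_add_one (ne_of_gt hx)]; ring
    have g2 : ∀ x y, 0 < x → pd2 f (x, y) = c * x ^ κ := fun x y hx => by
      refine (aux_d2 hf y hx).unique ?_
      have : (fun t => f (x, t)) = fun t => x ^ κ * (a + b * x + c * (t + x * Real.log x)) :=
        funext fun t => h0 x t hx
      rw [this]
      have := ((((hasDerivAt_id y).add_const (x * Real.log x)).const_mul c).const_add
        (a + b * x)).const_mul (x ^ κ)
      refine HasDerivAt.congr_deriv this (Eq.symm ?_)
      ring
    have hlin : ∀ x y, 0 < x → HasDerivAt (fun t => a + b * t + c * (y + t * Real.log t))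
        (b + c * (Real.log x + 1)) x := fun x y hx => by
      have := (((hasDerivAt_id x).const_mul b).const_add a).add
        ((((hasDerivAt_id x).mul (Real.hasDerivAt_log hx.ne')).const_add y).const_mul c)
      refine HasDerivAt.congr_deriv this (Eq.symm ?_)
      simp only [id]
      field_simp
    have g1 : ∀ x y, 0 < x → pd1 f (x, y) =
        κ * x ^ κ / x * (a + b * x + c * (y + x * Real.log x))
          + x ^ κ * (b + c * (Real.log x + 1)) := fun x y hx => by
      refine (aux_d1 hf y hx).unique ?_
      refine ((aux_pow κ hx).mul (hlin x y hx)).congr_of_eventuallyEq ?_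
      filter_upwards [lt_mem_nhds hx] with t ht using h0 t y ht
    refine ⟨hf, ?_⟩
    rintro ⟨x, y⟩ hx
    simp only at hx ⊢
    have g11 : pd1 (pd1 f) (x, y) =
        κ * (((κ * x ^ κ / x * x - x ^ κ * 1) / x ^ 2) * (a + b * x + c * (y + x * Real.log x))
          + x ^ κ / x * (b + c * (Real.log x + 1)))
          + (κ * x ^ κ / x * (b + c * (Real.log x + 1)) + x ^ κ * (c * x⁻¹)) := by
      refine (aux_d1 hf1 y hx).unique ?_
      have hd := (((((aux_pow κ hx).div (hasDerivAt_id x) hx.ne').mul (hlin x y hx)).const_mul κ).add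
        ((aux_pow κ hx).mul
          ((((Real.hasDerivAt_log hx.ne').add_const 1).const_mul c).const_add b)))
      refine HasDerivAt.congr_of_eventuallyEq hd ?_
      filter_upwards [lt_mem_nhds hx] with t ht
      rw [g1 t y ht]
      simp only [id, Pi.add_apply, Pi.mul_apply, Pi.div_apply]
      ring
    have g12 : pd1 (pd2 f) (x, y) = c * (κ * x ^ κ / x) := by
      refine (aux_d1 hf2 y hx).unique ?_
      refine ((aux_pow κ hx).const_mul c).congr_of_eventuallyEq ?_
      filter_upwards [lt_mem_nhds hx] with t ht using g2 t y ht
    have g22 : pd2 (pd2 f) (x, y) = 0 := by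
      refine (aux_d2 hf2 y hx).unique ?_
      have : (fun t => pd2 f (x, t)) = fun t => c * x ^ κ := funext fun t => g2 x t hx
      rw [this]
      exact hasDerivAt_const _ _
    refine ⟨?_, ?_, g22⟩
    · rw [g11, g1 x y hx, g2 x y hx, h0 x y hx]
      field_simp
      ring
    · rw [g12, g2 x y hx]
      ring
end

section
/- Let κ ∈ ℝ with κ(κ+1) ≠ 0 and let μ ∈ ℝ with μ ≠ −1 and D := 1/4 + κ(1+κ)(1+μ) > 0. For the Type B connection Z₁^κ on the half-plane {x¹ > 0} (Christoffel symbols Γ_{11}^1 = 2κ/x¹, Γ_{11}^2 = 1/x¹, Γ_{12}^2 = κ/x¹, others zero, with ρ_s = κ(1+κ)(x¹)^{-2}·dx¹⊗dx¹), the set of smooth f satisfying (Hf)₁₁ = μκ(1+κ)(x¹)^{-2}·f, (Hf)₁₂ = 0 and (Hf)₂₂ = 0 is exactly the real span of the two functions (x¹)^{α₊} and (x¹)^{α₋}, where α_± = 1/2 + κ ± √D. -/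
def HP : Set (ℝ × ℝ) := {p : ℝ × ℝ | 0 < p.1}

lemma HP_open : IsOpen HP := isOpen_lt continuous_const continuous_fst

lemma HP_nhds {p : ℝ × ℝ} (hp : 0 < p.1) : HP ∈ nhds p := HP_open.mem_nhds hp

def Sm (f : ℝ × ℝ → ℝ) : Prop := ContDiffOn ℝ (⊤ : ℕ∞) f HP

lemma Sm.at {f : ℝ × ℝ → ℝ} (h : Sm f) {p : ℝ × ℝ} (hp : 0 < p.1) :
    ContDiffAt ℝ (⊤ : ℕ∞) f p := h.contDiffAt (HP_nhds hp)

lemma Sm.diff {f : ℝ × ℝ → ℝ} (h : Sm f) {p : ℝ × ℝ} (hp : 0 < p.1) :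
    DifferentiableAt ℝ f p := (h.at hp).differentiableAt (by simp)

lemma Sm.fd {f : ℝ × ℝ → ℝ} (h : Sm f) : ContDiffOn ℝ (⊤ : ℕ∞) (fderiv ℝ f) HP :=
  ContDiffOn.fderiv_of_isOpen h HP_open (by simp)

lemma Sm.pd1 {f : ℝ × ℝ → ℝ} (h : Sm f) : Sm (pd1 f) :=
  h.fd.clm_apply contDiffOn_const

lemma Sm.pd2 {f : ℝ × ℝ → ℝ} (h : Sm f) : Sm (pd2 f) :=
  h.fd.clm_apply contDiffOn_const

lemma pd1_congr {f g : ℝ × ℝ → ℝ} (h : ∀ q : ℝ × ℝ, 0 < q.1 → f q = g q) {p : ℝ × ℝ}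
    (hp : 0 < p.1) : pd1 f p = pd1 g p := by
  have : f =ᶠ[nhds p] g := Filter.eventually_of_mem (HP_nhds hp) h
  simp only [pd1, this.fderiv_eq]

lemma pd2_congr {f g : ℝ × ℝ → ℝ} (h : ∀ q : ℝ × ℝ, 0 < q.1 → f q = g q) {p : ℝ × ℝ}
    (hp : 0 < p.1) : pd2 f p = pd2 g p := by
  have : f =ᶠ[nhds p] g := Filter.eventually_of_mem (HP_nhds hp) h
  simp only [pd2, this.fderiv_eq]

lemma pd_symm_s9 {f : ℝ × ℝ → ℝ} (h : Sm f) {p : ℝ × ℝ} (hp : 0 < p.1) :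
    pd2 (pd1 f) p = pd1 (pd2 f) p := by
  have hs : IsSymmSndFDerivAt ℝ f p := (h.at hp).isSymmSndFDerivAt (by simp; exact WithTop.coe_le_coe.mpr le_top)
  have hd : DifferentiableAt ℝ (fderiv ℝ f) p :=
    (h.fd.contDiffAt (HP_nhds hp)).differentiableAt (by simp)
  have e : ∀ v w : ℝ × ℝ, fderiv ℝ (fun q => fderiv ℝ f q v) p w = fderiv ℝ (fderiv ℝ f) p w v := by
    intro v w
    rw [fderiv_clm_apply hd (differentiableAt_const v)]
    simp
  change fderiv ℝ (fun q => fderiv ℝ f q (1,0)) p (0,1) = fderiv ℝ (fun q => fderiv ℝ f q (0,1)) p (1,0)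
  rw [e, e]
  exact hs.eq _ _

lemma hd1_s9 {h : ℝ × ℝ → ℝ} {p : ℝ × ℝ} (hd : DifferentiableAt ℝ h p) :
    HasDerivAt (fun t => h (t, p.2)) (pd1 h p) p.1 := by
  have h1 : HasDerivAt (fun t : ℝ => (t, p.2)) ((1:ℝ), (0:ℝ)) p.1 :=
    (hasDerivAt_id _).prodMk (hasDerivAt_const _ _)
  exact HasFDerivAt.comp_hasDerivAt (f := fun t : ℝ => (t, p.2)) p.1 hd.hasFDerivAt h1

lemma hd2_s9 {h : ℝ × ℝ → ℝ} {p : ℝ × ℝ} (hd : DifferentiableAt ℝ h p) :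
    HasDerivAt (fun t => h (p.1, t)) (pd2 h p) p.2 := by
  have h1 : HasDerivAt (fun t : ℝ => (p.1, t)) ((0:ℝ), (1:ℝ)) p.2 :=
    (hasDerivAt_const _ _).prodMk (hasDerivAt_id _)
  exact HasFDerivAt.comp_hasDerivAt (f := fun t : ℝ => (p.1, t)) p.2 hd.hasFDerivAt h1

lemma pd_fst {F : ℝ × ℝ → ℝ} {φ : ℝ → ℝ} {d : ℝ} (hF : ∀ q : ℝ × ℝ, 0 < q.1 → F q = φ q.1)
    {p : ℝ × ℝ} (hp : 0 < p.1) (h : HasDerivAt φ d p.1) : pd1 F p = d ∧ pd2 F p = 0 := by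
  have h1 : HasFDerivAt (fun q : ℝ × ℝ => φ q.1) _ p :=
    HasDerivAt.comp_hasFDerivAt (f := fun q : ℝ × ℝ => q.1) p h (hasFDerivAt_fst (𝕜 := ℝ) (E := ℝ) (F := ℝ) (p := p))
  rw [pd1_congr hF hp, pd2_congr hF hp]
  simp [pd1, pd2, h1.fderiv]

lemma ode_pow {u : ℝ → ℝ} {v : ℝ → ℝ} {α : ℝ} (hu : ∀ x, 0 < x → HasDerivAt u (v x) x)
    (h : ∀ x, 0 < x → x * v x = α * u x) : ∀ x, 0 < x → u x = u 1 * x ^ α := by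
  have hd : ∀ x : ℝ, 0 < x → HasDerivAt (fun x => u x * x ^ (-α)) 0 x := by
    intro x hx
    have := (hu x hx).mul (Real.hasDerivAt_rpow_const (p := -α) (Or.inl hx.ne'))
    refine this.congr_deriv ?_
    have e : x ^ (-α) = x * x ^ (-α - 1) := by
      rw [Real.rpow_sub_one hx.ne']; field_simp
    rw [e]
    linear_combination (x ^ (-α - 1)) * h x hx
  intro x hx
  have := IsOpen.is_const_of_deriv_eq_zero (f := fun x => u x * x ^ (-α)) isOpen_Ioi
    (isPreconnected_Ioi (a := (0:ℝ)))
    (fun y hy => (hd y hy).differentiableAt.differentiableWithinAt)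
    (fun y hy => (hd y hy).deriv) (show x ∈ Set.Ioi 0 from hx) (show (1:ℝ) ∈ Set.Ioi 0 from Set.mem_Ioi.mpr one_pos)
  simp only [Real.one_rpow, mul_one] at this
  rw [← this, mul_assoc, ← Real.rpow_add hx]; simp

lemma g_zero (κ μ : ℝ) (hκ : κ * (κ + 1) ≠ 0) (hμ : μ ≠ -1) {f : ℝ × ℝ → ℝ} (hf : Sm f)
    (h : ∀ p : ℝ × ℝ, 0 < p.1 →
        pd1 (pd1 f) p - (2 * κ / p.1) * pd1 f p - (1 / p.1) * pd2 f p
          = μ * (κ * (1 + κ) / p.1 ^ 2) * f p ∧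
        pd1 (pd2 f) p - (κ / p.1) * pd2 f p = 0 ∧
        pd2 (pd2 f) p = 0) (p : ℝ × ℝ) (hp : 0 < p.1) : pd2 f p = 0 := by
  have s2 := hf.pd2
  have s1 := hf.pd1
  have e1 : ∀ q : ℝ × ℝ, 0 < q.1 → pd1 (pd2 f) q = κ / q.1 * pd2 f q := fun q hq => by
    linarith [(h q hq).2.1]
  -- second derivative of g in direction 1
  have e2 : pd1 (pd1 (pd2 f)) p = (κ ^ 2 - κ) / p.1 ^ 2 * pd2 f p := by
    have a := hd1_s9 (s2.pd1.diff hp)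
    have b : HasDerivAt (fun t => κ / t * pd2 f (t, p.2)) _ p.1 :=
      (((hasDerivAt_const p.1 κ).div (hasDerivAt_id p.1) hp.ne')).mul (hd1_s9 (s2.diff hp))
    have c := b.congr_of_eventuallyEq (f₁ := fun t => pd1 (pd2 f) (t, p.2))
      (Filter.eventually_of_mem (Ioi_mem_nhds hp) (fun t ht => e1 (t, p.2) ht))
    rw [a.unique c, e1 p hp]
    simp
    field_simp
    ring
  have e3 : pd2 (pd1 (pd1 f)) p = pd1 (pd1 (pd2 f)) p := by
    rw [pd_symm_s9 s1 hp]
    exact pd1_congr (fun q hq => pd_symm_s9 hf hq) hp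
  have e4 := hd2_s9 (s1.pd1.diff hp)
  have e5 : HasDerivAt (fun t => (2 * κ / p.1) * pd1 f (p.1, t) + (1 / p.1) * pd2 f (p.1, t)
      + μ * (κ * (1 + κ) / p.1 ^ 2) * f (p.1, t)) _ p.2 :=
    (((hd2_s9 (s1.diff hp)).const_mul _).add ((hd2_s9 (s2.diff hp)).const_mul _)).add
      ((hd2_s9 (hf.diff hp)).const_mul _)
  have e6 : (fun t => pd1 (pd1 f) (p.1, t)) = (fun t => (2 * κ / p.1) * pd1 f (p.1, t)
      + (1 / p.1) * pd2 f (p.1, t) + μ * (κ * (1 + κ) / p.1 ^ 2) * f (p.1, t)) := by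
    funext t
    have := (h (p.1, t) hp).1
    simp only at this
    linarith
  rw [e6] at e4
  have e7 := e4.unique e5
  rw [e3, e2, pd_symm_s9 hf hp, e1 p hp, (h p hp).2.2] at e7
  field_simp at e7
  have e8 : (κ * (κ + 1)) * (1 + μ) * pd2 f p = 0 := by linear_combination -e7
  have : (1 + μ) ≠ 0 := fun h => hμ (by linarith)
  simpa [mul_ne_zero hκ this] using e8

/-- For the Type B model Z₁^κ with κ(κ+1) ≠ 0 and μ ≠ −1 such that
D = 1/4 + κ(1+κ)(1+μ) > 0, the smooth solutions of the affine quasi-Einstein equation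
with eigenvalue μ on {x¹ > 0} are exactly the span of (x¹)^{α₊} and (x¹)^{α₋},
where α_± = 1/2 + κ ± √D. -/
theorem stmt9 (κ μ : ℝ) (hκ : κ * (κ + 1) ≠ 0) (hμ : μ ≠ -1)
    (hD : 0 < 1 / 4 + κ * (1 + κ) * (1 + μ)) (f : ℝ × ℝ → ℝ) :
    (ContDiffOn ℝ (⊤ : ℕ∞) f {p : ℝ × ℝ | 0 < p.1} ∧
      ∀ p : ℝ × ℝ, 0 < p.1 →
        pd1 (pd1 f) p - (2 * κ / p.1) * pd1 f p - (1 / p.1) * pd2 f p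
          = μ * (κ * (1 + κ) / p.1 ^ 2) * f p ∧
        pd1 (pd2 f) p - (κ / p.1) * pd2 f p = 0 ∧
        pd2 (pd2 f) p = 0) ↔
    (∃ a b : ℝ, ∀ p : ℝ × ℝ, 0 < p.1 →
      f p = a * p.1 ^ (1 / 2 + κ + Real.sqrt (1 / 4 + κ * (1 + κ) * (1 + μ)))
          + b * p.1 ^ (1 / 2 + κ - Real.sqrt (1 / 4 + κ * (1 + κ) * (1 + μ)))) := by
  set s := Real.sqrt (1 / 4 + κ * (1 + κ) * (1 + μ)) with hs
  have hs0 : 0 < s := Real.sqrt_pos.mpr hD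
  have hs2 : s ^ 2 = 1 / 4 + κ * (1 + κ) * (1 + μ) := Real.sq_sqrt hD.le
  constructor
  · rintro ⟨hf, h⟩
    have hf : Sm f := hf
    have g0 := g_zero κ μ hκ hμ hf h
    have s1 := hf.pd1
    have hu : ∀ x : ℝ, 0 < x → HasDerivAt (fun t => f (t, 0)) (pd1 f (x, 0)) x :=
      fun x hx => hd1_s9 (p := (x, 0)) (hf.diff hx)
    have hv : ∀ x : ℝ, 0 < x → HasDerivAt (fun t => pd1 f (t, 0)) (pd1 (pd1 f) (x, 0)) x :=
      fun x hx => hd1_s9 (p := (x, 0)) (s1.diff hx)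
    have heq : ∀ x : ℝ, 0 < x → x ^ 2 * pd1 (pd1 f) (x, 0) =
        2 * κ * x * pd1 f (x, 0) + μ * (κ * (1 + κ)) * f (x, 0) := by
      intro x hx
      have := (h (x, 0) hx).1
      rw [g0 (x, 0) hx] at this
      simp only at this
      field_simp at this
      linear_combination this
    have key : ∀ r : ℝ, r ^ 2 = s ^ 2 → ∀ x : ℝ, 0 < x →
        x * pd1 f (x, 0) - (1 / 2 + κ - r) * f (x, 0) =
        (1 * pd1 f (1, 0) - (1 / 2 + κ - r) * f (1, 0)) * x ^ (1 / 2 + κ + r) := by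
      intro r hr
      refine ode_pow (u := fun x => x * pd1 f (x, 0) - (1 / 2 + κ - r) * f (x, 0))
        (fun x hx => ((hasDerivAt_id x).mul (hv x hx)).sub ((hu x hx).const_mul _)) ?_
      intro x hx
      simp only [id]
      linear_combination heq x hx - (hr + hs2) * f (x, 0)
    have ky : ∀ p : ℝ × ℝ, 0 < p.1 → f p = f (p.1, 0) := by
      intro p hp
      have hd : ∀ t, HasDerivAt (fun t => f (p.1, t)) 0 t := fun t => by
        have := hd2_s9 (p := (p.1, t)) (hf.diff hp)
        rwa [g0 (p.1, t) hp] at this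
      exact is_const_of_deriv_eq_zero (fun t => (hd t).differentiableAt)
        (fun t => (hd t).deriv) p.2 0
    refine ⟨(1 * pd1 f (1, 0) - (1 / 2 + κ - s) * f (1, 0)) / (2 * s),
      -(1 * pd1 f (1, 0) - (1 / 2 + κ - (-s)) * f (1, 0)) / (2 * s), fun p hp => ?_⟩
    have k1 := key s rfl p.1 hp
    have k2 := key (-s) (by ring) p.1 hp
    rw [ky p hp]
    rw [← sub_eq_add_neg] at k2
    generalize p.1 ^ (1 / 2 + κ + s) = X at *
    generalize p.1 ^ (1 / 2 + κ - s) = Y at *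
    have h2s : 2 * s ≠ 0 := by positivity
    rw [div_mul_eq_mul_div, div_mul_eq_mul_div, ← add_div, eq_div_iff h2s]
    linear_combination k1 - k2
  · rintro ⟨a, b, h⟩
    set α := 1 / 2 + κ + s with hα
    set β := 1 / 2 + κ - s with hβ
    have hdp : ∀ (a b α β x : ℝ), 0 < x → HasDerivAt (fun x : ℝ => a * x ^ α + b * x ^ β)
        (a * (α * x ^ (α - 1)) + b * (β * x ^ (β - 1))) x := fun a b α β x hx =>
      ((Real.hasDerivAt_rpow_const (Or.inl hx.ne')).const_mul a).add
        ((Real.hasDerivAt_rpow_const (Or.inl hx.ne')).const_mul b)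
    have p1 := fun (p : ℝ × ℝ) (hp : 0 < p.1) =>
      pd_fst (φ := fun x => a * x ^ α + b * x ^ β) h hp (hdp _ _ _ _ _ hp)
    have p11 := fun (p : ℝ × ℝ) (hp : 0 < p.1) =>
      pd_fst (F := pd1 f) (φ := fun x => (a * α) * x ^ (α - 1) + (b * β) * x ^ (β - 1))
        (fun q hq => by rw [(p1 q hq).1]; ring) hp (hdp _ _ _ _ _ hp)
    have p2 := fun (p : ℝ × ℝ) (hp : 0 < p.1) =>
      pd_fst (F := pd2 f) (φ := fun x => 0) (fun q hq => (p1 q hq).2) hp (hasDerivAt_const _ _)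
    refine ⟨?_, fun p hp => ⟨?_, ?_, ?_⟩⟩
    · refine ContDiffOn.congr (f := fun p : ℝ × ℝ => a * p.1 ^ α + b * p.1 ^ β) ?_ h
      have hr : ∀ γ : ℝ, ContDiffOn ℝ (⊤ : ℕ∞) (fun p : ℝ × ℝ => p.1 ^ γ) {p : ℝ × ℝ | 0 < p.1} :=
        fun γ => contDiffOn_fst.rpow_const_of_ne (fun p hp => ne_of_gt hp)
      exact (contDiffOn_const.mul (hr α)).add (contDiffOn_const.mul (hr β))
    · rw [(p11 p hp).1, (p1 p hp).1, (p1 p hp).2, h p hp]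
      simp only [Real.rpow_sub_one hp.ne']
      field_simp
      rw [hα, hβ]
      generalize p.1 ^ (1 / 2 + κ + s) = X
      generalize p.1 ^ (1 / 2 + κ - s) = Y
      linear_combination (a * X + b * Y) * hs2
    · rw [(p2 p hp).1, (p1 p hp).2]; simp
    · exact (p2 p hp).2
end

section
/- Let κ ∈ ℝ. Consider the Type B connection on the half-plane {x¹ > 0} with Christoffel symbols Γ_{11}^1 = (2κ−1)/x¹, Γ_{12}^2 = Γ_{21}^2 = κ/x¹ and all other Γ_{ij}^k = 0 (the model Z₃^κ, whose symmetric Ricci tensor is ρ_s = κ²(x¹)^{-2}·dx¹⊗dx¹). The set of smooth f on {x¹ > 0} satisfying (Hf)₁₁ = −κ²(x¹)^{-2}·f, (Hf)₁₂ = 0 and (Hf)₂₂ = 0 (the affine quasi-Einstein equation with μ = −1) is exactly the real span of the three functions (x¹)^κ, (x¹)^κ·x², and (x¹)^κ·log x¹. -/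
lemma half_nhds {p : ℝ × ℝ} (hp : 0 < p.1) : {p : ℝ × ℝ | 0 < p.1} ∈ nhds p :=
  (isOpen_lt continuous_const continuous_fst).mem_nhds hp

lemma slice1 {G : ℝ × ℝ → ℝ} {p : ℝ × ℝ} (h : DifferentiableAt ℝ G p) :
    HasDerivAt (fun t => G (t, p.2)) (pd1 G p) p.1 := by
  have h1 : HasDerivAt (fun t : ℝ => (t, p.2)) ((1 : ℝ), (0 : ℝ)) p.1 :=
    (hasDerivAt_id p.1).prodMk (hasDerivAt_const p.1 p.2)
  exact HasFDerivAt.comp_hasDerivAt (f := fun t : ℝ => (t, p.2)) p.1 h.hasFDerivAt h1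

lemma slice2 {G : ℝ × ℝ → ℝ} {p : ℝ × ℝ} (h : DifferentiableAt ℝ G p) :
    HasDerivAt (fun t => G (p.1, t)) (pd2 G p) p.2 := by
  have h1 : HasDerivAt (fun t : ℝ => (p.1, t)) ((0 : ℝ), (1 : ℝ)) p.2 :=
    (hasDerivAt_const p.2 p.1).prodMk (hasDerivAt_id p.2)
  exact HasFDerivAt.comp_hasDerivAt (f := fun t : ℝ => (p.1, t)) p.2 h.hasFDerivAt h1

lemma pd1_of {f F : ℝ × ℝ → ℝ} (hf : ∀ q : ℝ × ℝ, 0 < q.1 → f q = F q) {p : ℝ × ℝ}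
    (hp : 0 < p.1) (h : DifferentiableAt ℝ F p) {d : ℝ}
    (hd : HasDerivAt (fun t => F (t, p.2)) d p.1) : pd1 f p = d := by
  have : f =ᶠ[nhds p] F := Filter.mem_of_superset (half_nhds hp) hf
  rw [pd1, this.fderiv_eq]
  exact (slice1 h).unique hd

lemma pd2_of {f F : ℝ × ℝ → ℝ} (hf : ∀ q : ℝ × ℝ, 0 < q.1 → f q = F q) {p : ℝ × ℝ}
    (hp : 0 < p.1) (h : DifferentiableAt ℝ F p) {d : ℝ}
    (hd : HasDerivAt (fun t => F (p.1, t)) d p.2) : pd2 f p = d := by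
  have : f =ᶠ[nhds p] F := Filter.mem_of_superset (half_nhds hp) hf
  rw [pd2, this.fderiv_eq]
  exact (slice2 h).unique hd

lemma const_of_s12 {G : ℝ × ℝ → ℝ} (hG : ∀ p : ℝ × ℝ, 0 < p.1 → DifferentiableAt ℝ G p)
    (h1 : ∀ p : ℝ × ℝ, 0 < p.1 → HasDerivAt (fun t => G (t, p.2)) 0 p.1)
    (h2 : ∀ p : ℝ × ℝ, 0 < p.1 → HasDerivAt (fun t => G (p.1, t)) 0 p.2) :
    ∃ c, ∀ p : ℝ × ℝ, 0 < p.1 → G p = c := by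
  have ho : IsOpen {p : ℝ × ℝ | 0 < p.1} := isOpen_lt continuous_const continuous_fst
  have hc : Convex ℝ {p : ℝ × ℝ | 0 < p.1} :=
    (convex_Ioi (0 : ℝ)).linear_preimage (LinearMap.fst ℝ ℝ ℝ)
  refine ⟨G (1, 0), fun p hp => ?_⟩
  refine hc.is_const_of_fderivWithin_eq_zero (𝕜 := ℝ) (f := G)
    (fun q hq => (hG q hq).differentiableWithinAt) (fun q hq => ?_) hp
    (by simp)
  rw [fderivWithin_of_isOpen ho hq]
  have e1 : fderiv ℝ G q (1, 0) = 0 := (slice1 (hG q hq)).unique (h1 q hq)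
  have e2 : fderiv ℝ G q (0, 1) = 0 := (slice2 (hG q hq)).unique (h2 q hq)
  ext <;> simp [e1, e2]

lemma pd_smooth_s12 {f : ℝ × ℝ → ℝ} (hf : ContDiffOn ℝ (⊤ : ℕ∞) f {p : ℝ × ℝ | 0 < p.1}) :
    ∀ p : ℝ × ℝ, 0 < p.1 → DifferentiableAt ℝ f p ∧ DifferentiableAt ℝ (pd1 f) p ∧
      DifferentiableAt ℝ (pd2 f) p ∧ pd2 (pd1 f) p = pd1 (pd2 f) p := by
  intro p hp
  have h := hf.contDiffAt (half_nhds hp)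
  have h2 : DifferentiableAt ℝ (fderiv ℝ f) p :=
    (h.fderiv_right (m := 1) (by norm_cast)).differentiableAt (by simp)
  have hs : IsSymmSndFDerivAt ℝ f p := h.isSymmSndFDerivAt (by
    simp only [minSmoothness_of_isRCLikeNormedField]; exact WithTop.coe_le_coe.2 (le_top (a := (2 : ℕ∞))))
  refine ⟨h.differentiableAt (by simp), h2.clm_apply (differentiableAt_const _),
    h2.clm_apply (differentiableAt_const _), ?_⟩
  have e1 : fderiv ℝ (pd1 f) p (0, 1) = fderiv ℝ (fderiv ℝ f) p (0, 1) (1, 0) := by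
    unfold pd1
    rw [fderiv_clm_apply h2 (differentiableAt_const _)]
    simp
  have e2 : fderiv ℝ (pd2 f) p (1, 0) = fderiv ℝ (fderiv ℝ f) p (1, 0) (0, 1) := by
    unfold pd2
    rw [fderiv_clm_apply h2 (differentiableAt_const _)]
    simp
  change fderiv ℝ (pd1 f) p (0, 1) = fderiv ℝ (pd2 f) p (1, 0)
  rw [e1, e2]
  exact hs _ _

lemma rpow_diff {p : ℝ × ℝ} (hp : 0 < p.1) (r : ℝ) :
    DifferentiableAt ℝ (fun q : ℝ × ℝ => q.1 ^ r) p :=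
  differentiableAt_fst.rpow_const (Or.inl hp.ne')

lemma log_diff {p : ℝ × ℝ} (hp : 0 < p.1) :
    DifferentiableAt ℝ (fun q : ℝ × ℝ => Real.log q.1) p :=
  differentiableAt_fst.log hp.ne'

lemma rpow_der {x : ℝ} (hx : 0 < x) (r : ℝ) :
    HasDerivAt (fun t : ℝ => t ^ r) (r * (x ^ r / x)) x := by
  have := Real.hasDerivAt_rpow_const (x := x) (p := r) (Or.inl hx.ne')
  rwa [Real.rpow_sub_one hx.ne'] at this

lemma forward (κ : ℝ) (f : ℝ × ℝ → ℝ)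
    (hf : ContDiffOn ℝ (⊤ : ℕ∞) f {p : ℝ × ℝ | 0 < p.1})
    (h : ∀ p : ℝ × ℝ, 0 < p.1 →
        pd1 (pd1 f) p - ((2 * κ - 1) / p.1) * pd1 f p
          = -(κ ^ 2 / p.1 ^ 2) * f p ∧
        pd1 (pd2 f) p - (κ / p.1) * pd2 f p = 0 ∧
        pd2 (pd2 f) p = 0) :
    ∃ a b c : ℝ, ∀ p : ℝ × ℝ, 0 < p.1 →
      f p = a * p.1 ^ κ + b * (p.1 ^ κ * p.2) + c * (p.1 ^ κ * Real.log p.1) := by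
  have hs := pd_smooth_s12 hf
  obtain ⟨b, hb⟩ := const_of_s12 (G := fun q => pd2 f q * q.1 ^ (-κ))
    (fun p hp => (hs p hp).2.2.1.mul (rpow_diff hp _))
    (fun p hp => by
      refine ((slice1 (hs p hp).2.2.1).mul (rpow_der hp (-κ))).congr_deriv ?_
      have e := (h p hp).2.1
      have hp' := hp.ne'
      simp only [Prod.mk.eta]
      linear_combination p.1 ^ (-κ) * e)
    (fun p hp => by
      refine ((slice2 (hs p hp).2.2.1).mul_const (p.1 ^ (-κ))).congr_deriv ?_
      rw [(h p hp).2.2, zero_mul])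
  obtain ⟨c, hc⟩ := const_of_s12 (G := fun q => (q.1 * pd1 f q - κ * f q) * q.1 ^ (-κ))
    (fun p hp => ((differentiableAt_fst.mul (hs p hp).2.1).sub
      ((hs p hp).1.const_mul κ)).mul (rpow_diff hp _))
    (fun p hp => by
      refine ((((hasDerivAt_id p.1).mul (slice1 (hs p hp).2.1)).sub
        ((slice1 (hs p hp).1).const_mul κ)).mul (rpow_der hp (-κ))).congr_deriv ?_
      have e := (h p hp).1
      have hp' := hp.ne'
      have e' : pd1 (pd1 f) p =
        ((2 * κ - 1) / p.1) * pd1 f p - (κ ^ 2 / p.1 ^ 2) * f p := by linarith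
      simp [e']
      field_simp
      ring)
    (fun p hp => by
      refine ((((slice2 (hs p hp).2.1).const_mul p.1).sub
        ((slice2 (hs p hp).1).const_mul κ)).mul_const (p.1 ^ (-κ))).congr_deriv ?_
      have e := (h p hp).2.1
      have hp' := hp.ne'
      have e' : pd1 (pd2 f) p = (κ / p.1) * pd2 f p := by linarith
      rw [(hs p hp).2.2.2, e']
      field_simp
      ring)
  obtain ⟨a, ha⟩ := const_of_s12 (G := fun q => f q * q.1 ^ (-κ) - b * q.2 - c * Real.log q.1)
    (fun p hp => (((hs p hp).1.mul (rpow_diff hp _)).sub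
      (differentiableAt_snd.const_mul b)).sub ((log_diff hp).const_mul c))
    (fun p hp => by
      refine ((((slice1 (hs p hp).1).mul (rpow_der hp (-κ))).sub_const (b * p.2)).sub
        ((Real.hasDerivAt_log hp.ne').const_mul c)).congr_deriv ?_
      have hp' := hp.ne'
      rw [← hc p hp]
      simp only [Prod.mk.eta]
      field_simp
      ring)
    (fun p hp => by
      refine ((((slice2 (hs p hp).1).mul_const (p.1 ^ (-κ))).sub
        ((hasDerivAt_id p.2).const_mul b)).sub_const (c * Real.log p.1)).congr_deriv ?_
      rw [← hb p hp]
      simp)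
  refine ⟨a, b, c, fun p hp => ?_⟩
  have e := ha p hp
  have e2 : p.1 ^ (-κ) * p.1 ^ κ = 1 := by
    rw [← Real.rpow_add hp]; simp
  linear_combination p.1 ^ κ * e - f p * e2

lemma backward (κ : ℝ) (f : ℝ × ℝ → ℝ) (a b c : ℝ) (h : ∀ p : ℝ × ℝ, 0 < p.1 →
      f p = a * p.1 ^ κ + b * (p.1 ^ κ * p.2) + c * (p.1 ^ κ * Real.log p.1)) :
    ContDiffOn ℝ (⊤ : ℕ∞) f {p : ℝ × ℝ | 0 < p.1} ∧
      ∀ p : ℝ × ℝ, 0 < p.1 →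
        pd1 (pd1 f) p - ((2 * κ - 1) / p.1) * pd1 f p
          = -(κ ^ 2 / p.1 ^ 2) * f p ∧
        pd1 (pd2 f) p - (κ / p.1) * pd2 f p = 0 ∧
        pd2 (pd2 f) p = 0 := by
  have hf : ContDiffOn ℝ (⊤ : ℕ∞) f {p : ℝ × ℝ | 0 < p.1} := by
    refine ContDiffOn.congr (f := fun p : ℝ × ℝ => a * p.1 ^ κ + b * (p.1 ^ κ * p.2) +
      c * (p.1 ^ κ * Real.log p.1)) (fun p hp => ?_) h
    have hp' : p.1 ≠ 0 := ne_of_gt hp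
    have c1 : ContDiffAt ℝ (⊤ : ℕ∞) (fun q : ℝ × ℝ => q.1 ^ κ) p :=
      contDiffAt_fst.rpow_const_of_ne hp'
    have c2 : ContDiffAt ℝ (⊤ : ℕ∞) (fun q : ℝ × ℝ => Real.log q.1) p :=
      contDiffAt_fst.log hp'
    exact (((contDiffAt_const.mul c1).add (contDiffAt_const.mul (c1.mul contDiffAt_snd))).add
      (contDiffAt_const.mul (c1.mul c2))).contDiffWithinAt
  refine ⟨hf, ?_⟩
  have hs := pd_smooth_s12 hf
  have f2 : ∀ p : ℝ × ℝ, 0 < p.1 → pd2 f p = b * p.1 ^ κ := fun p hp => by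
    refine pd2_of (fun q _ => rfl) hp (hs p hp).1 ?_
    have : (fun t => f (p.1, t)) = fun t => a * p.1 ^ κ + b * (p.1 ^ κ * t) +
      c * (p.1 ^ κ * Real.log p.1) := funext fun t => h (p.1, t) hp
    rw [this]
    refine (((((hasDerivAt_id p.2).const_mul (p.1 ^ κ)).const_mul b).const_add _).add_const
      _).congr_deriv ?_
    simp
  have f1 : ∀ p : ℝ × ℝ, 0 < p.1 → pd1 f p =
      (p.1 ^ κ * (κ * (a + b * p.2 + c * Real.log p.1) + c)) / p.1 := fun p hp => by
    refine pd1_of (F := fun q => q.1 ^ κ * (a + b * q.2 + c * Real.log q.1))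
      (fun q hq => by rw [h q hq]; ring) hp ((rpow_diff hp _).mul
        (((differentiableAt_snd.const_mul b).const_add a).add ((log_diff hp).const_mul c))) ?_
    refine ((rpow_der hp κ).mul
      (((Real.hasDerivAt_log hp.ne').const_mul c).const_add (a + b * p.2))).congr_deriv ?_
    have hp' := hp.ne'
    field_simp
    try ring
  intro p hp
  have hp' := hp.ne'
  refine ⟨?_, ?_, ?_⟩
  · have : pd1 (pd1 f) p = (κ * (p.1 ^ κ / p.1) * (κ * (a + b * p.2 + c * Real.log p.1) + c)
        + p.1 ^ κ * (κ * (c * p.1⁻¹))) / p.1 -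
        (p.1 ^ κ * (κ * (a + b * p.2 + c * Real.log p.1) + c)) / p.1 ^ 2 := by
      refine pd1_of (F := fun q => (q.1 ^ κ * (κ * (a + b * q.2 + c * Real.log q.1) + c)) / q.1)
        f1 hp ((hs p hp).2.1.congr_of_eventuallyEq
          (Filter.mem_of_superset (half_nhds hp) fun q hq => (f1 q hq).symm)) ?_
      refine (((rpow_der hp κ).mul
        ((((Real.hasDerivAt_log hp.ne').const_mul c).const_add (a + b * p.2)).const_mul κ
          |>.add_const c)).div (hasDerivAt_id p.1) hp').congr_deriv ?_
      simp
      field_simp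
    rw [this, f1 p hp, h p hp]
    field_simp
    ring
  · have : pd1 (pd2 f) p = b * (κ * (p.1 ^ κ / p.1)) :=
      pd1_of (F := fun q => b * q.1 ^ κ) f2 hp ((rpow_diff hp _).const_mul b)
        ((rpow_der hp κ).const_mul b)
    rw [this, f2 p hp]
    field_simp
    try ring
  · exact pd2_of (F := fun q => b * q.1 ^ κ) f2 hp ((rpow_diff hp _).const_mul b)
      (hasDerivAt_const p.2 (b * p.1 ^ κ))

/-- For the Type B model Z₃^κ (Γ₁₁¹ = (2κ−1)/x¹, Γ₁₂² = κ/x¹, others zero,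
ρ_s = κ²(x¹)⁻²dx¹⊗dx¹) on {x¹ > 0}, the smooth solutions of the affine quasi-Einstein
equation with μ = −1 are exactly the span of (x¹)^κ, (x¹)^κ x² and (x¹)^κ log x¹. -/
theorem stmt12 (κ : ℝ) (f : ℝ × ℝ → ℝ) :
    (ContDiffOn ℝ (⊤ : ℕ∞) f {p : ℝ × ℝ | 0 < p.1} ∧
      ∀ p : ℝ × ℝ, 0 < p.1 →
        pd1 (pd1 f) p - ((2 * κ - 1) / p.1) * pd1 f p
          = -(κ ^ 2 / p.1 ^ 2) * f p ∧
        pd1 (pd2 f) p - (κ / p.1) * pd2 f p = 0 ∧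
        pd2 (pd2 f) p = 0) ↔
    (∃ a b c : ℝ, ∀ p : ℝ × ℝ, 0 < p.1 →
      f p = a * p.1 ^ κ + b * (p.1 ^ κ * p.2) + c * (p.1 ^ κ * Real.log p.1)) := by
  exact ⟨fun h => forward κ f h.1 h.2, fun ⟨a, b, c, h⟩ => backward κ f a b c h⟩
end

section
/- Let c ∈ ℝ. Consider the Type B connection Q_c on the half-plane {x¹ > 0} with Christoffel symbols Γ_{11}^2 = c/x¹, Γ_{12}^1 = Γ_{21}^1 = 1/x¹, Γ_{22}^2 = 1/x¹ and all other Γ_{ij}^k = 0. Then the symmetric part of the Ricci tensor of this connection vanishes identically, and every smooth f on {x¹ > 0} with vanishing affine Hessian (i.e., (Hf)₁₁ = (Hf)₁₂ = (Hf)₂₂ = 0) is constant; consequently for every μ ∈ ℝ the space of solutions of the affine quasi-Einstein equation Hf = μ f ρ_s consists exactly of the constant functions. -/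
/- Entries of ρ̃ = (x¹)²·ρ for the Type B model Q_c, i.e. the general formulas
ρ̃₁₁ = C₁₂²(1 + C₁₁¹ − C₁₂²) + C₁₁²(C₂₂² − C₁₂¹), ρ̃₁₂ = C₂₂² − C₁₁²C₂₂¹,
ρ̃₂₁ = −C₁₂¹ + C₁₂¹C₁₂² − C₁₁²C₂₂¹, ρ̃₂₂ = C₂₂¹(C₁₁¹ − C₁₂² − 1) + C₁₂¹C₂₂² − (C₁₂¹)²
evaluated at C₁₁² = c, C₁₂¹ = 1, C₂₂² = 1 and all other C's zero. -/
def qr11 (c : ℝ) : ℝ := 0 * (1 + 0 - 0) + c * (1 - 1)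
def qr12 (c : ℝ) : ℝ := 1 - c * 0
def qr21 (c : ℝ) : ℝ := -1 + 1 * 0 - c * 0
def qr22 (_c : ℝ) : ℝ := 0 * (0 - 0 - 1) + 1 * 1 - 1 ^ 2

abbrev hpU : Set (ℝ × ℝ) := {p : ℝ × ℝ | 0 < p.1}

lemma hpU_open : IsOpen hpU := isOpen_lt continuous_const continuous_fst

lemma hpU_nhds {p : ℝ × ℝ} (hp : 0 < p.1) : hpU ∈ nhds p := hpU_open.mem_nhds hp

lemma hp_smooth {f : ℝ × ℝ → ℝ} (hf : ContDiffOn ℝ (⊤ : ℕ∞) f hpU) (v : ℝ × ℝ) :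
    ContDiffOn ℝ (⊤ : ℕ∞) (fun p => fderiv ℝ f p v) hpU :=
  (hf.fderiv_of_isOpen hpU_open (by simp)).clm_apply contDiffOn_const

lemma hp_comm {f : ℝ × ℝ → ℝ} (hf : ContDiffOn ℝ (⊤ : ℕ∞) f hpU) {p : ℝ × ℝ} (hp : 0 < p.1) :
    pd1 (pd2 f) p = pd2 (pd1 f) p := by
  have h1 : ContDiffAt ℝ (⊤ : ℕ∞) f p := hf.contDiffAt (hpU_nhds hp)
  have hs : IsSymmSndFDerivAt ℝ f p := h1.isSymmSndFDerivAt (by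
    rw [minSmoothness_of_isRCLikeNormedField]; exact WithTop.coe_le_coe.2 (le_top : (2 : ℕ∞) ≤ ⊤))
  have hd : DifferentiableAt ℝ (fderiv ℝ f) p :=
    ((hf.fderiv_of_isOpen (m := (⊤ : ℕ∞)) hpU_open (by simp)).contDiffAt
      (hpU_nhds hp)).differentiableAt (by simp)
  have key : ∀ v w : ℝ × ℝ, fderiv ℝ (fun q => fderiv ℝ f q v) p w = fderiv ℝ (fderiv ℝ f) p w v := by
    intro v w
    rw [fderiv_clm_apply hd (differentiableAt_const v)]
    simp
  unfold pd1 pd2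
  rw [key, key]
  exact hs _ _

lemma hp_congr {f g : ℝ × ℝ → ℝ} (h : ∀ p : ℝ × ℝ, 0 < p.1 → f p = g p) {p : ℝ × ℝ}
    (hp : 0 < p.1) : fderiv ℝ f p = fderiv ℝ g p :=
  Filter.EventuallyEq.fderiv_eq (Filter.eventuallyEq_of_mem (hpU_nhds hp) (fun q hq => h q hq))

lemma hp_prod {g : ℝ × ℝ → ℝ} (hg : ContDiffOn ℝ (⊤ : ℕ∞) g hpU) {p : ℝ × ℝ} (hp : 0 < p.1)
    (v : ℝ × ℝ) : fderiv ℝ (fun q : ℝ × ℝ => q.1⁻¹ * g q) p v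
      = p.1⁻¹ * fderiv ℝ g p v - (p.1 ^ 2)⁻¹ * v.1 * g p := by
  have hd : HasFDerivAt g (fderiv ℝ g p) p :=
    ((hg.contDiffAt (hpU_nhds hp)).differentiableAt (by simp)).hasFDerivAt
  have hi : HasFDerivAt (fun q : ℝ × ℝ => q.1⁻¹) (-(p.1 ^ 2)⁻¹ • ContinuousLinearMap.fst ℝ ℝ ℝ) p :=
    (hasDerivAt_inv hp.ne').comp_hasFDerivAt p hasFDerivAt_fst
  have hm : HasFDerivAt (fun q : ℝ × ℝ => q.1⁻¹ * g q) _ p := hi.mul hd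
  rw [hm.fderiv]
  simp
  ring

lemma hp_main (c : ℝ) (f : ℝ × ℝ → ℝ) :
      (ContDiffOn ℝ (⊤ : ℕ∞) f {p : ℝ × ℝ | 0 < p.1} ∧
        ∀ p : ℝ × ℝ, 0 < p.1 →
          pd1 (pd1 f) p - (c / p.1) * pd2 f p = 0 ∧
          pd1 (pd2 f) p - (1 / p.1) * pd1 f p = 0 ∧
          pd2 (pd2 f) p - (1 / p.1) * pd2 f p = 0) ↔
      (∃ k : ℝ, ∀ p : ℝ × ℝ, 0 < p.1 → f p = k) := by
  constructor
  · rintro ⟨hf, h⟩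
    have s1 : ContDiffOn ℝ (⊤ : ℕ∞) (pd1 f) hpU := hp_smooth hf _
    have s2 : ContDiffOn ℝ (⊤ : ℕ∞) (pd2 f) hpU := hp_smooth hf _
    have e12 : ∀ p : ℝ × ℝ, 0 < p.1 → pd1 (pd2 f) p = p.1⁻¹ * pd1 f p := fun p hp => by
      have := (h p hp).2.1
      rw [one_div] at this; linarith
    have e22 : ∀ p : ℝ × ℝ, 0 < p.1 → pd2 (pd2 f) p = p.1⁻¹ * pd2 f p := fun p hp => by
      have := (h p hp).2.2
      rw [one_div] at this; linarith
    have v0 : ∀ p : ℝ × ℝ, 0 < p.1 → pd2 f p = 0 := by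
      intro p hp
      have hc := hp_comm s2 hp
      have hA : pd1 (pd2 (pd2 f)) p = p.1⁻¹ * pd1 (pd2 f) p - (p.1 ^ 2)⁻¹ * 1 * pd2 f p := by
        rw [pd1, hp_congr e22 hp, hp_prod s2 hp]; rfl
      have hB : pd2 (pd1 (pd2 f)) p = p.1⁻¹ * pd2 (pd1 f) p - (p.1 ^ 2)⁻¹ * 0 * pd1 f p := by
        rw [pd2, hp_congr e12 hp, hp_prod s1 hp]; rfl
      rw [hA, hB, ← hp_comm hf hp] at hc
      have : (p.1 ^ 2)⁻¹ * pd2 f p = 0 := by linarith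
      exact (mul_eq_zero.mp this).resolve_left (by positivity)
    have u0 : ∀ p : ℝ × ℝ, 0 < p.1 → pd1 f p = 0 := by
      intro p hp
      have h1 : pd1 (pd2 f) p = 0 := by
        rw [pd1, hp_congr (g := fun _ => 0) v0 hp]; simp
      rw [e12 p hp] at h1
      exact (mul_eq_zero.mp h1).resolve_left (by positivity)
    have hz : Set.EqOn (fderiv ℝ f) 0 hpU := by
      intro p hp
      ext
      · simpa [pd1] using u0 p hp
      · simpa [pd2] using v0 p hp
    have hconv : Convex ℝ hpU := (convex_Ioi (0:ℝ)).linear_preimage (LinearMap.fst ℝ ℝ ℝ)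
    refine ⟨f (1, 0), fun p hp => ?_⟩
    exact hpU_open.is_const_of_fderiv_eq_zero hconv.isPreconnected
      (hf.differentiableOn (by simp)) hz hp (by simp [hpU])
  · rintro ⟨k, hk⟩
    have a1 : ∀ p : ℝ × ℝ, 0 < p.1 → pd1 f p = 0 := fun p hp => by
      rw [pd1, hp_congr (g := fun _ => k) hk hp]; simp
    have a2 : ∀ p : ℝ × ℝ, 0 < p.1 → pd2 f p = 0 := fun p hp => by
      rw [pd2, hp_congr (g := fun _ => k) hk hp]; simp
    refine ⟨contDiffOn_const.congr (fun p hp => hk p hp), fun p hp => ?_⟩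
    have b1 : pd1 (pd1 f) p = 0 := by
      rw [pd1, hp_congr (g := fun _ => 0) a1 hp]; simp
    have b2 : pd1 (pd2 f) p = 0 := by
      rw [pd1, hp_congr (g := fun _ => 0) a2 hp]; simp
    have b3 : pd2 (pd2 f) p = 0 := by
      rw [pd2, hp_congr (g := fun _ => 0) a2 hp]; simp
    simp [b1, b2, b3, a1 p hp, a2 p hp]

/-- For the Type B model Q_c (Γ₁₁² = c/x¹, Γ₁₂¹ = 1/x¹, Γ₂₂² = 1/x¹, others zero) on
{x¹ > 0}: the symmetric part ρ_s of the Ricci tensor vanishes identically, every smooth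
function with vanishing affine Hessian is constant, and consequently for every μ ∈ ℝ
the solutions of Hf = μ f ρ_s are exactly the constant functions. -/
theorem stmt16 (c : ℝ) :
    (∀ p : ℝ × ℝ, 0 < p.1 →
      (qr11 c + qr11 c) / 2 / p.1 ^ 2 = 0 ∧
      (qr12 c + qr21 c) / 2 / p.1 ^ 2 = 0 ∧
      (qr22 c + qr22 c) / 2 / p.1 ^ 2 = 0) ∧
    (∀ f : ℝ × ℝ → ℝ,
      (ContDiffOn ℝ (⊤ : ℕ∞) f {p : ℝ × ℝ | 0 < p.1} ∧
        ∀ p : ℝ × ℝ, 0 < p.1 →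
          pd1 (pd1 f) p - (c / p.1) * pd2 f p = 0 ∧
          pd1 (pd2 f) p - (1 / p.1) * pd1 f p = 0 ∧
          pd2 (pd2 f) p - (1 / p.1) * pd2 f p = 0) ↔
      (∃ k : ℝ, ∀ p : ℝ × ℝ, 0 < p.1 → f p = k)) ∧
    (∀ μ : ℝ, ∀ f : ℝ × ℝ → ℝ,
      (ContDiffOn ℝ (⊤ : ℕ∞) f {p : ℝ × ℝ | 0 < p.1} ∧
        ∀ p : ℝ × ℝ, 0 < p.1 →
          pd1 (pd1 f) p - (c / p.1) * pd2 f p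
            = μ * f p * ((qr11 c + qr11 c) / 2 / p.1 ^ 2) ∧
          pd1 (pd2 f) p - (1 / p.1) * pd1 f p
            = μ * f p * ((qr12 c + qr21 c) / 2 / p.1 ^ 2) ∧
          pd2 (pd2 f) p - (1 / p.1) * pd2 f p
            = μ * f p * ((qr22 c + qr22 c) / 2 / p.1 ^ 2)) ↔
      (∃ k : ℝ, ∀ p : ℝ × ℝ, 0 < p.1 → f p = k)) := by
  have q1 : qr11 c + qr11 c = 0 := by simp [qr11]
  have q2 : qr12 c + qr21 c = 0 := by simp [qr12, qr21]
  have q3 : qr22 c + qr22 c = 0 := by simp [qr22]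
  simp only [q1, q2, q3, zero_div, mul_zero]
  exact ⟨fun _ _ => ⟨trivial, trivial, trivial⟩, hp_main c, fun _ => hp_main c⟩
end
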